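/- Let n → ∞. Under the GOE model, the probability that the minimum of the quadratic form x ↦ xᵀQx over the standard simplex Δ^{n-1} is strictly smaller than the minimum diagonal entry min_{1≤i≤n} Q_{ii} satisfies lim_{n→∞} (n/√(log n)) · μ_n{Q : min_{x∈Δ^{n-1}} xᵀQx < min_{1≤i≤n} Q_{ii}} = 2√(2π). (Up to a μ_n-null set, this event coincides with the event that the unique global optimizer is not a vertex of the simplex, i.e. κ_n > 1.) -/

import Mathlib

open MeasureTheory ProbabilityTheory Filter Matrix

/-- Build a symmetric matrix from diagonal coordinates and strictly
upper-triangular coordinates. -/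
noncomputable def goeMatrix (n : ℕ)
    (d : Fin n → ℝ) (o : {p : Fin n × Fin n // p.1 < p.2} → ℝ) :
    Matrix (Fin n) (Fin n) ℝ :=
  fun i j =>
    if h : i = j then d i
    else if h' : i < j then o ⟨(i, j), h'⟩
    else o ⟨(j, i), lt_of_le_of_ne (not_lt.mp h') (Ne.symm h)⟩

instance matrixMeasurableSpace (n : ℕ) :
    MeasurableSpace (Matrix (Fin n) (Fin n) ℝ) := by
  unfold Matrix; infer_instance

/-- The GOE model: the pushforward, under the symmetric-matrix assembly map, of
the product Gaussian measure with `N(0,1)` diagonal coordinates and `N(0,1/2)`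
strictly upper-triangular coordinates. -/
noncomputable def goeMeasure (n : ℕ) : Measure (Matrix (Fin n) (Fin n) ℝ) :=
  ((Measure.pi fun _ : Fin n => gaussianReal 0 1).prod
      (Measure.pi fun _ : {p : Fin n × Fin n // p.1 < p.2} =>
        gaussianReal 0 (1 / 2))).map
    (fun dq => goeMatrix n dq.1 dq.2)

namespace GOEAux
open Set Topology

/-- Standard normal density. -/
noncomputable def ph (x : ℝ) : ℝ := gaussianPDFReal 0 1 x
/-- Standard normal cdf. -/
noncomputable def gF (x : ℝ) : ℝ := cdf (gaussianReal 0 1) x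

lemma ph_eq (x : ℝ) : ph x = (Real.sqrt (2 * Real.pi))⁻¹ * Real.exp (-x ^ 2 / 2) := by
  simp [ph, gaussianPDFReal]

lemma ph_pos (x : ℝ) : 0 < ph x := gaussianPDFReal_pos _ _ _ one_ne_zero

lemma ph_cont : Continuous ph := by
  have : ph = fun x => (Real.sqrt (2 * Real.pi))⁻¹ * Real.exp (-x ^ 2 / 2) := funext ph_eq
  rw [this]; fun_prop

lemma ph_integrable : Integrable ph := integrable_gaussianPDFReal 0 1

lemma gF_eq (x : ℝ) : gF x = ∫ t in Iic x, ph t := by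
  rw [gF, cdf_eq_real, measureReal_def, gaussianReal_apply_eq_integral _ one_ne_zero,
    ENNReal.toReal_ofReal]
  · rfl
  · exact setIntegral_nonneg measurableSet_Iic fun t _ => (gaussianPDFReal_nonneg _ _ _)

lemma gF_deriv (x : ℝ) : HasDerivAt gF (ph x) x := by
  have h : gF = fun x => gF 0 + ∫ t in (0:ℝ)..x, ph t := by
    funext x
    rw [← intervalIntegral.integral_Iic_sub_Iic ph_integrable.integrableOn
      ph_integrable.integrableOn, gF_eq, gF_eq]; ring
  rw [h]
  exact (intervalIntegral.integral_hasDerivAt_right (ph_cont.intervalIntegrable _ _)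
    (ph_cont.stronglyMeasurableAtFilter _ _) ph_cont.continuousAt).const_add _

lemma gF_cont : Continuous gF := continuous_iff_continuousAt.2 fun x => (gF_deriv x).continuousAt

lemma gF_strictMono : StrictMono gF :=
  strictMono_of_hasDerivAt_pos gF_deriv ph_pos

lemma gF_bot : Tendsto gF atBot (𝓝 0) := tendsto_cdf_atBot _
lemma gF_top : Tendsto gF atTop (𝓝 1) := tendsto_cdf_atTop _

lemma gF_pos (x : ℝ) : 0 < gF x :=
  lt_of_le_of_lt (cdf_nonneg _ (x - 1)) (gF_strictMono (by linarith))
lemma gF_lt_one (x : ℝ) : gF x < 1 :=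
  lt_of_lt_of_le (gF_strictMono (show x < x + 1 by linarith)) (cdf_le_one _ (x + 1))

lemma gF_range : gF '' univ = Ioo 0 1 := by
  ext u
  constructor
  · rintro ⟨x, -, rfl⟩; exact ⟨gF_pos x, gF_lt_one x⟩
  · rintro ⟨h0, h1⟩
    obtain ⟨a, ha⟩ := (gF_bot.eventually (gt_mem_nhds h0)).exists
    obtain ⟨b, hb⟩ := (gF_top.eventually (lt_mem_nhds h1)).exists
    obtain ⟨c, hc⟩ := mem_range_of_exists_le_of_exists_ge gF_cont ⟨a, ha.le⟩ ⟨b, hb.le⟩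
    exact ⟨c, trivial, hc⟩

/-- Quantile function -/
noncomputable def gI (u : ℝ) : ℝ := Function.invFun gF u

lemma gI_gF (x : ℝ) : gI (gF x) = x := Function.leftInverse_invFun gF_strictMono.injective x

lemma gF_gI {u : ℝ} (hu : u ∈ Ioo (0:ℝ) 1) : gF (gI u) = u := by
  rw [← gF_range] at hu
  obtain ⟨x, -, rfl⟩ := hu
  rw [gI_gF]

lemma gI_mono : MonotoneOn gI (Ioo 0 1) := by
  intro u hu v hv huv
  rw [← gF_strictMono.le_iff_le, gF_gI hu, gF_gI hv]; exact huv

lemma gI_tendsto : Tendsto gI (𝓝[>] 0) atBot := by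
  rw [tendsto_atBot]
  intro b
  have : Ioo 0 (gF b) ∈ 𝓝[>] (0:ℝ) := Ioo_mem_nhdsGT (gF_pos b)
  filter_upwards [this] with u hu
  rw [← gF_strictMono.le_iff_le, gF_gI ⟨hu.1, hu.2.trans (gF_lt_one b)⟩]
  exact hu.2.le

lemma integral_gauss (f : ℝ → ℝ) :
    ∫ x, f x ∂(gaussianReal 0 1) = ∫ u in Ioo (0:ℝ) 1, f (gI u) := by
  rw [integral_gaussianReal_eq_integral_smul one_ne_zero, ← gF_range,
    integral_image_eq_integral_abs_deriv_smul (f' := ph) MeasurableSet.univ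
      (fun x _ => (gF_deriv x).hasDerivWithinAt) gF_strictMono.injective.injOn]
  simp only [gI_gF, abs_of_pos (ph_pos _), Measure.restrict_univ]
  rfl

lemma sq_atBot : Tendsto (fun x : ℝ => x ^ 2) atBot atTop := by
  have := (tendsto_pow_atTop (α := ℝ) two_ne_zero).comp tendsto_neg_atBot_atTop
  refine this.congr fun x => ?_
  simp

/-- Mills ratio -/
lemma mills : Tendsto (fun x => gF x / (-(ph x) / x)) atBot (𝓝 1) := by
  have hphd : ∀ x, HasDerivAt ph (-x * ph x) x := by
    intro x
    have : ph = fun x => (Real.sqrt (2 * Real.pi))⁻¹ * Real.exp (-x ^ 2 / 2) := funext ph_eq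
    rw [this]
    have h1 : HasDerivAt (fun x : ℝ => -x ^ 2 / 2) (-x) x := by
      have := ((hasDerivAt_pow 2 x).neg.div_const 2)
      exact this.congr_deriv (by push_cast; ring)
    exact (h1.exp.const_mul _).congr_deriv (by ring)
  have hph0 : Tendsto ph atBot (𝓝 0) := by
    have : ph = fun x => (Real.sqrt (2 * Real.pi))⁻¹ * Real.exp (-x ^ 2 / 2) := funext ph_eq
    rw [this]
    rw [show (0:ℝ) = (Real.sqrt (2 * Real.pi))⁻¹ * 0 by ring]
    refine Tendsto.const_mul _ (Real.tendsto_exp_atBot.comp ?_)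
    have h2 : Tendsto (fun x : ℝ => x ^ 2 / 2) atBot atTop :=
      ((sq_atBot).atTop_div_const (by norm_num))
    have := tendsto_neg_atTop_atBot.comp h2
    refine this.congr fun x => ?_
    simp; ring
  refine HasDerivAt.lhopital_zero_atBot (f' := ph) (g' := fun x => ph x * (1 + 1 / x ^ 2))
    (Eventually.of_forall gF_deriv) ?_ ?_ gF_bot ?_ ?_
  · filter_upwards [eventually_lt_atBot 0] with x hx
    have := (hphd x).neg.div (hasDerivAt_id x) hx.ne
    exact this.congr_deriv (by simp only [Pi.neg_apply, id]; field_simp [hx.ne]; ring)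
  · filter_upwards [eventually_lt_atBot 0] with x hx
    have := ph_pos x
    positivity
  · have := hph0.neg.mul (tendsto_inv_atBot_zero (𝕜 := ℝ))
    simpa [div_eq_mul_inv] using this
  · have h : Tendsto (fun x : ℝ => 1 / (1 + 1 / x ^ 2)) atBot (𝓝 (1 / (1 + 0))) := by
      refine Tendsto.div tendsto_const_nhds (tendsto_const_nhds.add ?_) (by norm_num)
      exact tendsto_const_nhds.div_atTop (sq_atBot)
    rw [show (1:ℝ) / (1+0) = 1 by norm_num] at h
    refine h.congr fun x => ?_
    have := (ph_pos x).ne'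
    field_simp

end GOEAux

namespace GOEAux
open Set Topology

lemma gI_measurable : Measurable gI := by
  refine measurable_of_Iic fun a => ?_
  have h : gI ⁻¹' Iic a = (Ioo 0 1 ∩ Iic (gF a)) ∪
      ((Ioo 0 1)ᶜ ∩ {_u : ℝ | Classical.arbitrary ℝ ≤ a}) := by
    ext u
    by_cases hu : u ∈ Ioo (0:ℝ) 1
    · simp only [mem_preimage, mem_Iic, mem_union, mem_inter_iff, hu, true_and, mem_compl_iff,
        not_true_eq_false, false_and, or_false]
      rw [← gF_strictMono.le_iff_le, gF_gI hu]
    · have : gI u = Classical.arbitrary ℝ := by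
        refine Function.invFun_neg ?_
        rintro ⟨x, hx⟩
        apply hu; rw [← gF_range]; exact ⟨x, trivial, hx⟩
      simp [this, hu]
  rw [h]
  exact (measurableSet_Ioo.inter measurableSet_Iic).union
    (measurableSet_Ioo.compl.inter (MeasurableSet.const _))

/-- the N(0,1/2) cdf -/
noncomputable def pp (x : ℝ) : ℝ := gF (Real.sqrt 2 * x)

lemma pp_pos (x : ℝ) : 0 < pp x := gF_pos _
lemma pp_lt_one (x : ℝ) : pp x < 1 := gF_lt_one _
lemma pp_cont : Continuous pp := gF_cont.comp (continuous_const.mul continuous_id)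

noncomputable def mil (x : ℝ) : ℝ := gF x / (-(ph x) / x)

lemma gF_mil {x : ℝ} (hx : x < 0) : gF x = mil x * ph x / (-x) := by
  have := (ph_pos x).ne'
  have := hx.ne
  rw [mil]; field_simp

lemma mil_pos {x : ℝ} (hx : x < 0) : 0 < mil x := by
  have := ph_pos x
  have := gF_pos x
  rw [mil, show -(ph x)/x = ph x / (-x) by field_simp]
  have : 0 < -x := by linarith
  positivity

lemma tend_sqrt2 : Tendsto (fun x : ℝ => Real.sqrt 2 * x) atBot atBot :=
  tendsto_id.const_mul_atBot (by positivity)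

lemma ratio_pp : Tendsto (fun x => pp x / (gF x ^ 2 * (-x))) atBot (𝓝 (Real.sqrt Real.pi)) := by
  have h : Tendsto (fun x => mil (Real.sqrt 2 * x) / (mil x) ^ 2 * Real.sqrt Real.pi) atBot
      (𝓝 (1 / 1 ^ 2 * Real.sqrt Real.pi)) :=
    ((mills.comp tend_sqrt2).div (mills.pow 2) (by norm_num)).mul tendsto_const_nhds
  rw [show (1:ℝ) / 1 ^ 2 * Real.sqrt Real.pi = Real.sqrt Real.pi by ring] at h
  refine h.congr' ?_
  filter_upwards [eventually_lt_atBot 0] with x hx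
  have hx2 : Real.sqrt 2 * x < 0 := mul_neg_of_pos_of_neg (by positivity) hx
  have hm := mil_pos hx
  have hsq : Real.sqrt 2 ^ 2 = 2 := Real.sq_sqrt (by norm_num)
  have hpisq : Real.sqrt Real.pi ^ 2 = Real.pi := Real.sq_sqrt Real.pi_pos.le
  have he : Real.exp (-(Real.sqrt 2 * x) ^ 2 / 2) = Real.exp (-x ^ 2 / 2) ^ 2 := by
    rw [← Real.exp_nat_mul, mul_pow, hsq]; congr 1; push_cast; ring
  have e := Real.exp_pos (-x ^ 2 / 2)
  rw [pp, gF_mil hx2, gF_mil hx, ph_eq, ph_eq, he, Real.sqrt_mul (by norm_num)]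
  have : Real.sqrt 2 ≠ 0 := by positivity
  have : Real.sqrt Real.pi ≠ 0 := by positivity
  have : x ≠ 0 := hx.ne
  have : mil x ≠ 0 := hm.ne'
  field_simp

lemma log_gF : Tendsto (fun x => Real.log (1 / gF x) / x ^ 2) atBot (𝓝 (1 / 2)) := by
  have h1 : Tendsto (fun x => (-Real.log (mil x) - Real.log (Real.sqrt (2 * Real.pi))⁻¹) / x ^ 2)
      atBot (𝓝 0) :=
    Tendsto.div_atTop (((mills.log (by norm_num)).neg).sub tendsto_const_nhds) sq_atBot
  have h2 : Tendsto (fun x : ℝ => Real.log (-x) / (-x) ^ 2) atBot (𝓝 0) := by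
    have := (isLittleO_log_rpow_atTop (r := 2) (by norm_num)).tendsto_div_nhds_zero
    have := this.comp tendsto_neg_atBot_atTop
    refine this.congr fun x => ?_
    simp [Function.comp]
  have := (h1.add h2).add (tendsto_const_nhds (x := (1/2 : ℝ)))
  rw [show (0:ℝ) + 0 + 1/2 = 1/2 by norm_num] at this
  refine this.congr' ?_
  filter_upwards [eventually_lt_atBot 0] with x hx
  have hm := mil_pos hx
  have h0 := ph_pos x
  have hx' : 0 < -x := by linarith
  rw [gF_mil hx, one_div (_ / _), Real.log_inv (_ / _), Real.log_div (by positivity) (by positivity),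
    Real.log_mul (by positivity) (by positivity), ph_eq, Real.log_mul (by positivity) (by positivity),
    Real.log_exp]
  have : x ≠ 0 := hx.ne
  field_simp
  ring

lemma ratio_main : Tendsto (fun x => pp x / (gF x ^ 2 * Real.sqrt (Real.log (1 / gF x)))) atBot
    (𝓝 (Real.sqrt (2 * Real.pi))) := by
  have h := ratio_pp.div (log_gF.sqrt) (by positivity)
  have e : Real.sqrt Real.pi / Real.sqrt (1/2) = Real.sqrt (2 * Real.pi) := by
    rw [← Real.sqrt_div' _ (by norm_num)]; congr 1; ring
  rw [e] at h
  refine h.congr' ?_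
  filter_upwards [eventually_lt_atBot 0] with x hx
  have hx' : 0 < -x := by linarith
  have h0 := gF_pos x
  have hl : 0 < Real.log (1 / gF x) := Real.log_pos (by rw [lt_div_iff₀ h0]; linarith [gF_lt_one x])
  simp only [Pi.div_apply]
  rw [Real.sqrt_div hl.le, Real.sqrt_sq_eq_abs, abs_of_neg hx]
  have := hx.ne
  field_simp

/-- eventual bounds -/
lemma ev_pp : ∀ᶠ x in atBot, pp x ≤ 4 * (-x) * gF x ^ 2 := by
  have hpi : Real.sqrt Real.pi < 4 := by
    rw [Real.sqrt_lt' (by norm_num)]; linarith [Real.pi_lt_four]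
  filter_upwards [ratio_pp.eventually (gt_mem_nhds hpi), eventually_lt_atBot 0] with x h hx
  have h0 := gF_pos x
  have hx' : 0 < -x := by linarith
  rw [div_lt_iff₀ (by positivity)] at h
  linarith

lemma ev_ph : ∀ᶠ x in atBot, ph x ≤ 2 * (-x) * gF x := by
  filter_upwards [mills.eventually (lt_mem_nhds (show (1/2:ℝ) < 1 by norm_num)),
    eventually_lt_atBot 0] with x h hx
  have h0 := ph_pos x
  have hx' : 0 < -x := by linarith
  rw [show -(ph x)/x = ph x / (-x) by field_simp, lt_div_iff₀ (by positivity)] at h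
  rw [mul_div_assoc', div_lt_iff₀ hx'] at h
  linarith

lemma gF_pow (k : ℕ) : Tendsto (fun x => (-x) ^ k * gF x) atBot (𝓝 0) := by
  -- |x|^k gF ≤ |x|^k * exp(-x²/4)
  have hlog : Tendsto (fun x => Real.log ((-x) ^ k * gF x)) atBot atBot := by
    have h2 : Tendsto (fun x : ℝ => Real.log (-x) / (-x) ^ 2) atBot (𝓝 0) := by
      have := (isLittleO_log_rpow_atTop (r := 2) (by norm_num)).tendsto_div_nhds_zero
      have := this.comp tendsto_neg_atBot_atTop
      refine this.congr fun x => ?_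
      simp [Function.comp]
    have h3 := (h2.const_mul (k : ℝ)).sub log_gF
    have h4 := h3.neg_mul_atTop (by norm_num) sq_atBot
    refine h4.congr' ?_
    filter_upwards [eventually_lt_atBot 0] with x hx
    have hx' : 0 < -x := by linarith
    have h0 := gF_pos x
    rw [Real.log_mul (by positivity) (by positivity), Real.log_pow, one_div, Real.log_inv]
    have : x ≠ 0 := hx.ne
    field_simp
    ring
  have := Real.tendsto_exp_atBot.comp hlog
  refine this.congr' ?_
  filter_upwards [eventually_lt_atBot 0] with x hx
  have hx' : 0 < -x := by linarith
  have h0 := gF_pos x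
  simp only [Function.comp]
  rw [Real.exp_log (by positivity)]

/-- globalize bounds -/
lemma globalize (f : ℝ → ℝ) (hf : ∀ x, f x ≤ 1) (k : ℕ) (C : ℝ)
    (h : ∀ᶠ x in atBot, f x ≤ C * gF x ^ k) : ∃ C', 0 < C' ∧ ∀ x, f x ≤ C' * gF x ^ k := by
  obtain ⟨a, ha⟩ := eventually_atBot.1 h
  refine ⟨max C 1 + 1 / gF a ^ k, ?_, fun x => ?_⟩
  · have := gF_pos a; positivity
  · have h0 := gF_pos a
    have h1 := gF_pos x
    rcases le_total x a with hx | hx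
    · refine (ha x hx).trans ?_
      gcongr
      exact (le_max_left _ _).trans (le_add_of_nonneg_right (by positivity))
    · refine (hf x).trans ?_
      have : gF a ^ k ≤ gF x ^ k := by gcongr; exact gF_strictMono.monotone hx
      have h2 : 1 ≤ 1 / gF a ^ k * gF x ^ k := by
        rw [one_div, inv_mul_eq_div, one_le_div (by positivity)]; exact this
      have : 0 ≤ max C 1 * gF x ^ k := by positivity
      linarith

lemma pp_cube : ∃ C, 0 < C ∧ ∀ x, pp x ^ 3 ≤ C * gF x ^ 5 := by
  refine globalize _ (fun x => pow_le_one₀ (pp_pos x).le (pp_lt_one x).le) 5 64 ?_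
  filter_upwards [ev_pp, eventually_lt_atBot 0,
    (gF_pow 3).eventually (gt_mem_nhds one_pos)] with x h hx h3
  have h0 := gF_pos x
  calc pp x ^ 3 ≤ (4 * (-x) * gF x ^ 2) ^ 3 := by gcongr; exact (pp_pos x).le
    _ = 64 * gF x ^ 5 * ((-x) ^ 3 * gF x) := by ring
    _ ≤ 64 * gF x ^ 5 * 1 := by gcongr
    _ = _ := by ring

lemma pp_sq : ∃ C, 0 < C ∧ ∀ x, pp x ^ 2 ≤ C * gF x ^ 3 := by
  refine globalize _ (fun x => pow_le_one₀ (pp_pos x).le (pp_lt_one x).le) 3 16 ?_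
  filter_upwards [ev_pp, eventually_lt_atBot 0,
    (gF_pow 2).eventually (gt_mem_nhds one_pos)] with x h hx h3
  have h0 := gF_pos x
  calc pp x ^ 2 ≤ (4 * (-x) * gF x ^ 2) ^ 2 := by gcongr; exact (pp_pos x).le
    _ = 16 * gF x ^ 3 * ((-x) ^ 2 * gF x) := by ring
    _ ≤ 16 * gF x ^ 3 * 1 := by gcongr
    _ = _ := by ring

end GOEAux

namespace GOEAux
open Set Topology

lemma gam_int (k : ℕ) {r : ℝ} (hr : 0 < r) :
    IntegrableOn (fun t : ℝ => t ^ k * Real.exp (-(r * t))) (Ioi 0) := by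
  have := integrableOn_rpow_mul_exp_neg_mul_rpow (p := 1) (s := k) (b := r)
    (by have : (0:ℝ) ≤ k := by positivity
        linarith) one_pos hr
  refine this.congr_fun (fun t ht => ?_) measurableSet_Ioi
  simp

lemma gam_val (k : ℕ) {r : ℝ} (hr : 0 < r) :
    ∫ t in Ioi (0:ℝ), t ^ k * Real.exp (-(r * t)) = (k.factorial : ℝ) / r ^ (k + 1) := by
  have := Real.integral_rpow_mul_exp_neg_mul_Ioi (a := (k : ℝ) + 1) (by positivity) hr
  rw [Real.Gamma_nat_eq_factorial] at this
  simp only [add_sub_cancel_right, Real.rpow_natCast] at this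
  rw [this, show (k : ℝ) + 1 = ((k + 1 : ℕ) : ℝ) by push_cast; ring, Real.rpow_natCast]
  rw [one_div, inv_pow]; field_simp

lemma one_sub_pow_le_exp {u : ℝ} (hu : u ≤ 1) (N : ℕ) :
    (1 - u) ^ N ≤ Real.exp (-(N * u)) := by
  have h1 : 1 - u ≤ Real.exp (-u) := by linarith [Real.add_one_le_exp (-u)]
  calc (1 - u) ^ N ≤ Real.exp (-u) ^ N := by gcongr
    _ = _ := by rw [← Real.exp_nat_mul]; congr 1; ring

lemma moment (N k : ℕ) (hN : 0 < N) (f : ℝ → ℝ) (hf0 : ∀ x, 0 ≤ f x) (C : ℝ)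
    (hf : ∀ x, f x ≤ C * gF x ^ k) :
    ∫ x, (1 - gF x) ^ N * f x ∂(gaussianReal 0 1) ≤ C * (k.factorial / (N:ℝ) ^ (k + 1)) := by
  have hN' : (0:ℝ) < N := by exact_mod_cast hN
  have hC : 0 ≤ C := by
    by_contra hC
    have := (hf0 0).trans (hf 0)
    have h0 := gF_pos 0
    have : 0 < gF 0 ^ k := by positivity
    nlinarith
  rw [integral_gauss, ← gam_val k hN', ← integral_const_mul]
  have hi : IntegrableOn (fun u : ℝ => C * (u ^ k * Real.exp (-(N * u)))) (Ioi 0) :=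
    (gam_int k hN').const_mul C
  calc _ ≤ ∫ u in Ioo (0:ℝ) 1, C * (u ^ k * Real.exp (-(N * u))) := by
        refine integral_mono_of_nonneg ?_ (hi.mono_set Ioo_subset_Ioi_self) ?_
        · refine ae_restrict_of_forall_mem measurableSet_Ioo fun u hu => ?_
          have : 0 ≤ 1 - gF (gI u) := by linarith [gF_lt_one (gI u)]
          have := hf0 (gI u)
          simp only [Pi.zero_apply]; positivity
        · refine ae_restrict_of_forall_mem measurableSet_Ioo fun u hu => ?_
          have := hf (gI u)
          simp only [gF_gI hu] at this ⊢
          calc (1 - u) ^ N * f (gI u) ≤ Real.exp (-(N * u)) * (C * u ^ k) := by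
                gcongr
                · exact hf0 _
                · exact one_sub_pow_le_exp hu.2.le N
            _ = _ := by ring
    _ ≤ _ := by
        refine setIntegral_mono_set hi ?_ Ioo_subset_Ioi_self.eventuallyLE
        refine ae_restrict_of_forall_mem measurableSet_Ioi fun u hu => ?_
        have : (0:ℝ) < u := hu
        simp only [Pi.zero_apply]; positivity

lemma abel (g : ℝ → ℝ) (hgm : Measurable g) (h0 : ∀ u, 0 ≤ g u) (h1 : ∀ u, g u ≤ 1) (c : ℝ)
    (hlim : Tendsto (fun u => g u / (u ^ 2 * Real.sqrt (Real.log (1 / u)))) (𝓝[>] 0) (𝓝 c)) :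
    Tendsto (fun n : ℕ => (n:ℝ) ^ 3 / Real.sqrt (Real.log n) *
      ∫ u in Ioo (0:ℝ) 1, (1 - u) ^ (n - 1) * g u) atTop (𝓝 (2 * c)) := by
  -- global bound
  obtain ⟨C, hC, hgC⟩ : ∃ C, 0 < C ∧ ∀ u ∈ Ioo (0:ℝ) 1,
      g u ≤ C * (u ^ 2 * Real.sqrt (1 + Real.log (1 / u))) := by
    have h2 := hlim.eventually (gt_mem_nhds (show c < |c| + 1 by linarith [le_abs_self c]))
    obtain ⟨δ, hδ, hδ'⟩ := (mem_nhdsGT_iff_exists_Ioo_subset).1 h2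
    have hδ0 : (0:ℝ) < δ := hδ
    refine ⟨|c| + 1 + 1 / δ ^ 2, by positivity, fun u hu => ?_⟩
    have hu0 := hu.1
    have hl : 0 < Real.log (1 / u) := Real.log_pos (by rw [lt_div_iff₀ hu.1]; linarith [hu.2])
    rcases lt_or_ge u δ with h | h
    · have := hδ' ⟨hu.1, h⟩
      simp only [mem_ofPred_eq] at this
      rw [div_lt_iff₀ (by positivity)] at this
      refine this.le.trans ?_
      have q1 : |c| + 1 ≤ |c| + 1 + 1 / δ ^ 2 := le_add_of_nonneg_right (by positivity)
      have q2 : Real.log (1 / u) ≤ 1 + Real.log (1 / u) := by linarith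
      exact mul_le_mul q1 (mul_le_mul_of_nonneg_left (Real.sqrt_le_sqrt q2) (by positivity))
        (by positivity) (by positivity)
    · refine (h1 u).trans ?_
      have e1 : 1 ≤ 1 / δ ^ 2 * u ^ 2 := by
        rw [one_div, inv_mul_eq_div, one_le_div (by positivity)]; gcongr
      have e2 : 1 ≤ Real.sqrt (1 + Real.log (1 / u)) := Real.one_le_sqrt.2 (by linarith)
      calc (1:ℝ) ≤ (1 / δ ^ 2 * u ^ 2) * Real.sqrt (1 + Real.log (1 / u)) := by nlinarith
        _ ≤ _ := by
          rw [mul_assoc]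
          gcongr
          have := abs_nonneg c
          linarith
  set Fn : ℕ → ℝ → ℝ := fun n v => (n:ℝ) ^ 2 / Real.sqrt (Real.log n) *
    (Ioo (0:ℝ) 1).indicator (fun u => (1 - u) ^ (n - 1) * g u) (v / n) with hFn
  have hinteg : ∀ᶠ n : ℕ in atTop, ∫ v in Ioi (0:ℝ), Fn n v = (n:ℝ) ^ 3 / Real.sqrt (Real.log n) *
      ∫ u in Ioo (0:ℝ) 1, (1 - u) ^ (n - 1) * g u := by
    filter_upwards [eventually_gt_atTop 0] with n hn
    have hn' : (0:ℝ) < n := by exact_mod_cast hn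
    rw [setIntegral_eq_integral_of_forall_compl_eq_zero]
    · simp only [hFn]
      rw [integral_const_mul, Measure.integral_comp_div, integral_indicator measurableSet_Ioo,
        abs_of_pos hn', smul_eq_mul]
      ring
    · intro v hv
      have : v / n ∉ Ioo (0:ℝ) 1 := fun h => hv (by
        have := h.1
        rw [div_pos_iff_of_pos_right hn'] at this
        exact this)
      simp [hFn, this]
  refine Tendsto.congr' hinteg ?_
  have hval : ∫ v in Ioi (0:ℝ), c * (v ^ 2 * Real.exp (-(1 * v))) = 2 * c := by
    rw [integral_const_mul, gam_val 2 one_pos]; simp [Nat.factorial]; ring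
  rw [← hval]
  refine tendsto_integral_filter_of_dominated_convergence
    (fun v => C * (2 * (v ^ 2 * Real.exp (-(1/2 * v))) + v ^ 1 * Real.exp (-(1/2 * v)))) ?_ ?_ ?_ ?_
  · refine Eventually.of_forall fun n => Measurable.aestronglyMeasurable ?_
    refine Measurable.const_mul ?_ _
    refine Measurable.comp (Measurable.indicator (by fun_prop) measurableSet_Ioo) (by fun_prop)
  · filter_upwards [eventually_ge_atTop 3] with n hn
    refine ae_restrict_of_forall_mem measurableSet_Ioi fun v hv => ?_
    have hv0 : (0:ℝ) < v := hv
    have hn3 : (3:ℝ) ≤ n := by exact_mod_cast hn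
    have hn' : (0:ℝ) < n := by linarith
    have hl1 : 1 ≤ Real.log n := by
      rw [Real.le_log_iff_exp_le hn']; linarith [Real.exp_one_lt_d9]
    by_cases hvn : v / n ∈ Ioo (0:ℝ) 1
    swap
    · simp only [hFn, indicator_of_notMem hvn, mul_zero, norm_zero]; positivity
    simp only [hFn, indicator_of_mem hvn]
    have hpos1 : 0 ≤ 1 - v / n := by linarith [hvn.2]
    rw [Real.norm_of_nonneg (by have := h0 (v/n); positivity)]
    have e1 : (1 - v / n) ^ (n - 1) ≤ Real.exp (-(1/2 * v)) := by
      refine (one_sub_pow_le_exp hvn.2.le _).trans (Real.exp_le_exp.2 ?_)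
      rw [Nat.cast_sub (by omega)]
      have : (1:ℝ)/2 ≤ ((n:ℝ) - (1:ℕ)) / n := by rw [le_div_iff₀ hn']; push_cast; linarith
      have := mul_le_mul_of_nonneg_right this hv0.le
      have e : ((n:ℝ) - (1:ℕ)) / n * v = ((n:ℝ) - (1:ℕ)) * (v / n) := by ring
      linarith
    have e2 : Real.sqrt (1 + Real.log (1 / (v / n))) ≤ Real.sqrt (Real.log n) * (2 + 1 / v) := by
      have e3 : 1 + Real.log (1 / (v / n)) ≤ Real.log n * (2 + 1 / v) := by
        rw [one_div_div, Real.log_div (by positivity) (by positivity)]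
        have := Real.add_one_le_exp (-Real.log v)
        rw [Real.exp_neg, Real.exp_log hv0] at this
        have : 0 < 1 / v := by positivity
        have e5 : v⁻¹ = 1 / v := by simp
        nlinarith
      have e4 : (2 + 1 / v) ≤ (2 + 1 / v) ^ 2 := by
        have : 0 < 1 / v := by positivity
        nlinarith
      calc _ ≤ Real.sqrt (Real.log n * (2 + 1 / v) ^ 2) := by
            apply Real.sqrt_le_sqrt
            refine e3.trans ?_
            gcongr
        _ = _ := by rw [Real.sqrt_mul (by linarith), Real.sqrt_sq (by positivity)]
    have hs : 0 < Real.sqrt (Real.log n) := Real.sqrt_pos.2 (by linarith)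
    calc (n:ℝ) ^ 2 / Real.sqrt (Real.log n) * ((1 - v / n) ^ (n - 1) * g (v / n))
        ≤ (n:ℝ) ^ 2 / Real.sqrt (Real.log n) * (Real.exp (-(1/2 * v)) *
          (C * ((v / n) ^ 2 * (Real.sqrt (Real.log n) * (2 + 1 / v))))) := by
          gcongr
          · exact h0 _
          · exact (hgC _ hvn).trans (by gcongr)
      _ = _ := by field_simp
  · exact (((gam_int 2 (by norm_num)).const_mul 2).add (gam_int 1 (by norm_num))).const_mul C
  · refine ae_restrict_of_forall_mem measurableSet_Ioi fun v hv => ?_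
    have hv0 : (0:ℝ) < v := hv
    have hdiv : Tendsto (fun n : ℕ => v / (n:ℝ)) atTop (𝓝 0) :=
      tendsto_const_nhds.div_atTop tendsto_natCast_atTop_atTop
    have hdiv' : Tendsto (fun n : ℕ => v / (n:ℝ)) atTop (𝓝[>] 0) := by
      refine tendsto_nhdsWithin_iff.2 ⟨hdiv, ?_⟩
      filter_upwards [eventually_gt_atTop 0] with n hn
      have hn' : (0:ℝ) < n := by exact_mod_cast hn
      exact div_pos hv0 hn'
    have l1 := hlim.comp hdiv'
    have l2 : Tendsto (fun n : ℕ => (1 + (-v) / (n:ℝ)) ^ n / (1 - v / n)) atTop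
        (𝓝 (Real.exp (-v) / (1 - 0))) :=
      (Real.tendsto_one_add_div_pow_exp (-v)).div (tendsto_const_nhds.sub hdiv) (by norm_num)
    have hlog : Tendsto (fun n : ℕ => Real.log (n:ℝ)) atTop atTop :=
      Real.tendsto_log_atTop.comp tendsto_natCast_atTop_atTop
    have l3 : Tendsto (fun n : ℕ => Real.sqrt (1 - Real.log v / Real.log n)) atTop
        (𝓝 (Real.sqrt (1 - 0))) :=
      (tendsto_const_nhds.sub (tendsto_const_nhds.div_atTop hlog)).sqrt
    have l4 := ((l1.mul l2).mul l3).mul (tendsto_const_nhds (x := v ^ 2))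
    have e : c * (Real.exp (-v) / (1 - 0)) * Real.sqrt (1 - 0) * v ^ 2 =
      c * (v ^ 2 * Real.exp (-(1 * v))) := by simp; ring
    rw [e] at l4
    refine l4.congr' ?_
    filter_upwards [hdiv'.eventually (Ioo_mem_nhdsGT one_pos), eventually_gt_atTop 1] with n hvn hn
    have hn1 : (1:ℝ) < n := by exact_mod_cast hn
    have hn' : (0:ℝ) < n := by linarith
    simp only [hFn, indicator_of_mem (show v / (n:ℝ) ∈ Ioo (0:ℝ) 1 from hvn), Function.comp]
    have hl : 0 < Real.log n := Real.log_pos hn1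
    have hl2 : 0 < Real.log (1 / (v / n)) :=
      Real.log_pos (by rw [lt_div_iff₀ hvn.1]; linarith [hvn.2])
    have e1 : 1 - Real.log v / Real.log n = Real.log (1 / (v / n)) / Real.log n := by
      rw [one_div_div, Real.log_div (by positivity) (by positivity)]; field_simp
    rw [e1, Real.sqrt_div hl2.le]
    have e2 : (1 + (-v) / (n:ℝ)) ^ n = (1 - v / n) ^ (n - 1) * (1 - v / n) := by
      rw [← pow_succ, Nat.sub_add_cancel (by omega)]; ring
    rw [e2]
    have h5 : (1 - v / n) ≠ 0 := by linarith [hvn.2]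
    have h6 : Real.sqrt (Real.log (1 / (v / n))) ≠ 0 := by positivity
    rw [mul_div_assoc, div_self h5]
    generalize Real.sqrt (Real.log (1 / (v / n))) = s at *
    generalize (1 - v / n) ^ (n - 1) = s' at *
    field_simp

/-- main term -/
lemma main_term : Tendsto (fun n : ℕ => (n:ℝ) ^ 3 / Real.sqrt (Real.log n) *
      ∫ x, (1 - gF x) ^ (n - 1) * pp x ∂(gaussianReal 0 1)) atTop
      (𝓝 (2 * Real.sqrt (2 * Real.pi))) := by
  have := abel (fun u => pp (gI u)) (pp_cont.measurable.comp gI_measurable)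
    (fun u => (pp_pos _).le) (fun u => (pp_lt_one _).le) (Real.sqrt (2 * Real.pi)) ?_
  · refine this.congr fun n => ?_
    rw [integral_gauss]
    congr 1
    refine setIntegral_congr_fun measurableSet_Ioo fun u hu => ?_
    simp only [gF_gI hu]
  · refine (ratio_main.comp gI_tendsto).congr' ?_
    filter_upwards [Ioo_mem_nhdsGT (one_pos (α := ℝ))] with u hu
    simp only [Function.comp, gF_gI hu]

end GOEAux

namespace GOEAux
open Set Topology
open scoped ENNReal

lemma gF_shift {x s : ℝ} (hs : 0 ≤ s) : gF (x - s) ≤ gF x * Real.exp (x * s) := by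
  rw [gF_eq, gF_eq, ← integral_indicator measurableSet_Iic, ← integral_mul_const,
    ← integral_indicator measurableSet_Iic,
    ← integral_sub_right_eq_self (fun t => (Iic (x - s)).indicator ph t) s]
  have hinteg : Integrable ((Iic x).indicator fun t => ph t * Real.exp (x * s)) :=
    (ph_integrable.mul_const _).indicator measurableSet_Iic
  refine integral_mono_of_nonneg (Eventually.of_forall fun t => ?_) hinteg
    (Eventually.of_forall fun t => ?_)
  · exact indicator_nonneg (fun t _ => (ph_pos t).le) _
  · by_cases ht : t ≤ x
    · have h1 : t - s ∈ Iic (x - s) := by simp only [mem_Iic]; linarith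
      have h2 : t ∈ Iic x := ht
      simp only [indicator_of_mem h1, indicator_of_mem h2]
      rw [ph_eq, ph_eq, mul_assoc, ← Real.exp_add]
      gcongr
      nlinarith [sq_nonneg s]
    · have h1 : t - s ∉ Iic (x - s) := by simp only [mem_Iic]; linarith
      have h2 : t ∉ Iic x := ht
      simp only [indicator_of_notMem h1, indicator_of_notMem h2, le_refl]

lemma pp_shift {x s : ℝ} (hs : 0 ≤ s) : pp (x - s) ≤ pp x * Real.exp (2 * x * s) := by
  have := gF_shift (x := Real.sqrt 2 * x) (s := Real.sqrt 2 * s) (by positivity)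
  have e : Real.sqrt 2 * x * (Real.sqrt 2 * s) = 2 * x * s := by
    have := Real.mul_self_sqrt (show (0:ℝ) ≤ 2 by norm_num)
    linear_combination (x * s) * this
  rw [e] at this
  rw [pp, pp, mul_sub]; exact this

lemma ph_le (x z : ℝ) : ph z = ph x * Real.exp (-x * (z - x)  - (z - x) ^ 2 / 2 + 0) := by
  rw [ph_eq, ph_eq, mul_assoc, ← Real.exp_add]; congr 2; ring_nf

lemma lint_gauss (S : Set ℝ) (hS : MeasurableSet S) (f b : ℝ → ℝ) (hf : Measurable f)
    (h : ∀ z ∈ S, ph z * f z ≤ b z) :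
    ∫⁻ z in S, ENNReal.ofReal (f z) ∂(gaussianReal 0 1) ≤ ∫⁻ z in S, ENNReal.ofReal (b z) := by
  rw [gaussianReal_of_var_ne_zero _ one_ne_zero, restrict_withDensity hS,
    lintegral_withDensity_eq_lintegral_mul _ (measurable_gaussianPDF _ _) hf.ennreal_ofReal]
  refine setLIntegral_mono' hS fun z hz => ?_
  simp only [Pi.mul_apply, gaussianPDF]
  rw [← ENNReal.ofReal_mul (gaussianPDFReal_nonneg _ _ _)]
  exact ENNReal.ofReal_le_ofReal (h z hz)

/-- kernel -/
noncomputable def ker (x y z : ℝ) : ℝ := Real.exp (x * Real.sqrt ((y - x) * (z - x)))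

lemma ker_meas (x y : ℝ) : Measurable (ker x y) := by unfold ker; fun_prop

lemma ph_ker (x y z : ℝ) : ph z * ker x y z =
    ph x * Real.exp (-(-x) * (Real.sqrt ((y - x) * (z - x)) - (z - x)) - (z - x) ^ 2 / 2) := by
  rw [ph_le x z, ker, mul_assoc, ← Real.exp_add]; congr 2; ring

lemma sqrt_ge {u v : ℝ} (hv : 0 ≤ v) (huv : v ≤ u) : v ≤ Real.sqrt (u * v) := by
  apply Real.le_sqrt_of_sq_le; nlinarith

lemma inner1 {x y : ℝ} (hx : x < 0) (hy : y < x / 2) :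
    ∫⁻ z in Icc x y, ENNReal.ofReal (ker x y z) ∂(gaussianReal 0 1) ≤
      ENNReal.ofReal (ph x * ((-x) / 2)) := by
  refine (lint_gauss _ measurableSet_Icc _ (fun _ => ph x) (ker_meas x y) ?_).trans ?_
  · intro z hz
    rw [ph_ker]
    have := sqrt_ge (u := y - x) (v := z - x) (by linarith [hz.1]) (by linarith [hz.2])
    have h2 : Real.exp (-(-x) * (Real.sqrt ((y - x) * (z - x)) - (z - x)) - (z - x) ^ 2 / 2) ≤ 1 := by
      rw [Real.exp_le_one_iff]
      nlinarith [sq_nonneg (z - x)]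
    nlinarith [ph_pos x]
  · rw [setLIntegral_const, Real.volume_Icc, ENNReal.ofReal_mul (ph_pos x).le]
    gcongr
    linarith

lemma inner2 {x y : ℝ} (hx : x < 0) (hy : x / 2 ≤ y)
    (hB1 : Real.exp (-Real.sqrt (-x) / 3) ≤ 1 / x ^ 2) (hB2 : Real.exp (-x ^ 2 / 256) ≤ 1 / x ^ 2) :
    ∫⁻ z in Icc x y, ENNReal.ofReal (ker x y z) ∂(gaussianReal 0 1) ≤
      ENNReal.ofReal (ph x * (5 / x ^ 2)) := by
  have hX : 0 < -x := by linarith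
  have hx2 : 0 < x ^ 2 := by have := hx.ne; positivity
  set b : ℝ → ℝ := fun z => ph x * ((Icc x (x + 1 / x ^ 2)).indicator (fun _ => 1) z +
    1 / x ^ 2 * Real.exp (-(1/4) * (z - x) ^ 2)) with hb
  have hgi : Integrable (fun z => Real.exp (-(1/4) * (z - x) ^ 2)) :=
    (integrable_exp_neg_mul_sq (b := 1/4) (by norm_num)).comp_sub_right x
  have hii : Integrable ((Icc x (x + 1 / x ^ 2)).indicator (fun _ => (1:ℝ))) := by
    rw [integrable_indicator_iff measurableSet_Icc]
    exact integrableOn_const (by simp) (by simp)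
  have hbi : Integrable b := (hii.add (hgi.const_mul _)).const_mul _
  have hb0 : ∀ z, 0 ≤ b z := by
    intro z
    have : 0 ≤ (Icc x (x + 1 / x ^ 2)).indicator (fun _ => (1:ℝ)) z :=
      indicator_nonneg (fun _ _ => zero_le_one) _
    have := ph_pos x
    positivity
  refine (lint_gauss _ measurableSet_Icc _ b (ker_meas x y) ?_).trans ?_
  · intro z hz
    rw [ph_ker, hb]
    have hp := ph_pos x
    simp only
    gcongr
    have hv : 0 ≤ z - x := by linarith [hz.1]
    have huv : z - x ≤ y - x := by linarith [hz.2]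
    have hu : (-x) / 2 ≤ y - x := by linarith
    generalize hv' : z - x = v at *
    generalize hu' : y - x = u at *
    have hs := sqrt_ge hv huv
    by_cases h1 : v ≤ 1 / x ^ 2
    · have : z ∈ Icc x (x + 1 / x ^ 2) := ⟨hz.1, by linarith⟩
      rw [indicator_of_mem this]
      have h2 : Real.exp (-(-x) * (Real.sqrt (u * v) - v) - v ^ 2 / 2) ≤ 1 := by
        rw [Real.exp_le_one_iff]
        nlinarith [sq_nonneg v]
      have : 0 < 1 / x ^ 2 * Real.exp (-(1/4) * v ^ 2) := by positivity
      linarith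
    · have : z ∉ Icc x (x + 1 / x ^ 2) := fun h => h1 (by linarith [h.2])
      rw [indicator_of_notMem this, zero_add]
      push Not at h1
      have hu0 : 0 < u := by linarith
      by_cases h4 : v ≤ u / 4
      · have e1 : v ≤ Real.sqrt (u * v) / 2 := by
          have : 2 * v ≤ Real.sqrt (u * v) := by
            apply Real.le_sqrt_of_sq_le; nlinarith
          linarith
        have e2 : Real.sqrt (-x) / 3 ≤ (-x) * (Real.sqrt (u * v) / 2) := by
          have h5 : Real.sqrt (-x) * (2 / 3) ≤ (-x) * Real.sqrt (u * v) := by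
            have e5 : (-x) * Real.sqrt (u * v) = Real.sqrt ((-x) ^ 2 * (u * v)) := by
              rw [Real.sqrt_mul (x := (-x) ^ 2) (by positivity), Real.sqrt_sq hX.le]
            rw [e5]
            apply Real.le_sqrt_of_sq_le
            rw [mul_pow, Real.sq_sqrt hX.le]
            have e6 : 1 ≤ x ^ 2 * v := by
              rw [div_lt_iff₀ hx2] at h1; linarith
            have e7 : (-x) ^ 2 * (u * v) = u * (x ^ 2 * v) := by ring
            rw [e7]
            nlinarith
          linarith
        calc _ ≤ Real.exp (-Real.sqrt (-x) / 3 + -(1/4) * v ^ 2) := by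
              apply Real.exp_le_exp.2
              have : (-x) * (Real.sqrt (u * v) / 2) ≤ (-x) * (Real.sqrt (u * v) - v) := by
                apply mul_le_mul_of_nonneg_left _ hX.le; linarith
              nlinarith [sq_nonneg v]
          _ = Real.exp (-Real.sqrt (-x) / 3) * Real.exp (-(1/4) * v ^ 2) := Real.exp_add _ _
          _ ≤ _ := by gcongr
      · push Not at h4
        calc _ ≤ Real.exp (-x ^ 2 / 256 + -(1/4) * v ^ 2) := by
              apply Real.exp_le_exp.2
              have : 0 ≤ (-x) * (Real.sqrt (u * v) - v) := mul_nonneg hX.le (by linarith)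
              have h8 : (-x) / 8 ≤ v := by linarith
              have : ((-x) / 8) ^ 2 ≤ v ^ 2 := by gcongr
              nlinarith
          _ = Real.exp (-x ^ 2 / 256) * Real.exp (-(1/4) * v ^ 2) := Real.exp_add _ _
          _ ≤ _ := by gcongr
  · refine (setLIntegral_le_lintegral _ _).trans ?_
    rw [← ofReal_integral_eq_lintegral_ofReal hbi (Eventually.of_forall hb0)]
    apply ENNReal.ofReal_le_ofReal
    rw [hb, integral_const_mul]
    have hp := ph_pos x
    gcongr
    rw [integral_add hii (hgi.const_mul _), integral_indicator measurableSet_Icc,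
      integral_const_mul, integral_sub_right_eq_self (fun z => Real.exp (-(1/4) * z ^ 2)) x,
      integral_gaussian]
    have h4 : Real.sqrt (Real.pi / (1/4)) ≤ 4 := by
      rw [Real.sqrt_le_left (by norm_num)]; linarith [Real.pi_lt_four]
    have h5 : ∫ _z in Icc x (x + 1 / x ^ 2), (1:ℝ) = 1 / x ^ 2 := by
      simp [hx2.le]
    rw [h5]
    have : 1 / x ^ 2 * Real.sqrt (Real.pi / (1/4)) ≤ 1 / x ^ 2 * 4 := by gcongr
    calc _ ≤ 1 / x ^ 2 + 1 / x ^ 2 * 4 := by linarith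
      _ = _ := by ring

noncomputable def Hf (x : ℝ) : ℝ≥0∞ :=
  ∫⁻ y in Ici x, ∫⁻ z in Ici x,
    ENNReal.ofReal (pp (x - 1 / 2 * Real.sqrt ((y - x) * (z - x))))
    ∂(gaussianReal 0 1) ∂(gaussianReal 0 1)

lemma Hf_le_one (x : ℝ) : Hf x ≤ 1 := by
  unfold Hf
  calc _ ≤ ∫⁻ y in Ici x, ∫⁻ z in Ici x, 1 ∂(gaussianReal 0 1) ∂(gaussianReal 0 1) := by
        refine lintegral_mono fun y => lintegral_mono fun z => ?_
        rw [← ENNReal.ofReal_one]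
        exact ENNReal.ofReal_le_ofReal (pp_lt_one _).le
    _ ≤ ∫⁻ y in Ici x, 1 ∂(gaussianReal 0 1) := by
        refine lintegral_mono fun y => ?_
        rw [setLIntegral_one]
        exact prob_le_one
    _ ≤ 1 := by
        rw [setLIntegral_one]
        exact prob_le_one

lemma gauss_Iio (x : ℝ) : gaussianReal 0 1 (Iio x) = ENNReal.ofReal (gF x) := by
  have := nullSingletonClass_gaussianReal (μ := 0) (one_ne_zero (α := NNReal))
  rw [gF, ofReal_cdf]
  exact measure_congr Iio_ae_eq_Iic

lemma Hf_ev : ∀ᶠ x in atBot, Hf x ≤ ENNReal.ofReal (88 * gF x ^ 3) := by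
  have hsq : Tendsto (fun x : ℝ => Real.sqrt (-x)) atBot atTop :=
    Real.tendsto_sqrt_atTop.comp tendsto_neg_atBot_atTop
  have hB1 : ∀ᶠ x : ℝ in atBot, Real.exp (-Real.sqrt (-x) / 3) ≤ 1 / x ^ 2 := by
    have h := (tendsto_rpow_mul_exp_neg_mul_atTop_nhds_zero 4 (1/3)
      (by norm_num)).comp hsq
    filter_upwards [h.eventually (gt_mem_nhds one_pos), eventually_lt_atBot 0] with x h hx
    simp only [Function.comp] at h
    rw [show (4:ℝ) = ((4:ℕ):ℝ) by norm_num, Real.rpow_natCast] at h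
    have hX : 0 < -x := by linarith
    have e : Real.sqrt (-x) ^ 4 = x ^ 2 := by
      rw [show 4 = 2 * 2 by rfl, pow_mul, Real.sq_sqrt hX.le]; ring
    rw [e] at h
    rw [le_div_iff₀ (by have := hx.ne; positivity), show -Real.sqrt (-x) / 3 = -(1/3) * Real.sqrt (-x) by ring]
    linarith
  have hB2 : ∀ᶠ x : ℝ in atBot, Real.exp (-x ^ 2 / 256) ≤ 1 / x ^ 2 := by
    have h := (tendsto_rpow_mul_exp_neg_mul_atTop_nhds_zero 1 (1/256)
      (by norm_num)).comp sq_atBot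
    filter_upwards [h.eventually (gt_mem_nhds one_pos), eventually_lt_atBot 0] with x h hx
    simp only [Function.comp, Real.rpow_one] at h
    rw [le_div_iff₀ (by have := hx.ne; positivity), show -x ^ 2 / 256 = -(1/256) * x ^ 2 by ring]
    linarith
  have hB3 : ∀ᶠ x : ℝ in atBot, gF (x / 2) ≤ 1 / (-x) ^ 3 := by
    have h := (gF_pow 3).comp (tendsto_id.atBot_div_const (show (0:ℝ) < 2 by norm_num))
    filter_upwards [h.eventually (gt_mem_nhds (show (0:ℝ) < 1/8 by norm_num)),
      eventually_lt_atBot 0] with x h hx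
    simp only [Function.comp, id] at h
    have hX : 0 < -x := by linarith
    rw [le_div_iff₀ (by positivity)]
    have e : (-(x/2)) ^ 3 = (-x) ^ 3 / 8 := by ring
    rw [e] at h
    linarith
  filter_upwards [hB1, hB2, hB3, ev_pp, ev_ph, eventually_lt_atBot 0] with x hB1 hB2 hB3 h4 h5 hx
  have hX : 0 < -x := by linarith
  have hp := pp_pos x
  set γ := gaussianReal 0 1 with hγ
  have kmeas : Measurable (fun q : ℝ × ℝ => ENNReal.ofReal (ker x q.1 q.2)) := by
    unfold ker; fun_prop
  -- triangle integral
  set T := ∫⁻ y in Ici x, ∫⁻ z in Icc x y, ENNReal.ofReal (ker x y z) ∂γ ∂γ with hT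
  have hTle : T ≤ ENNReal.ofReal (ph x * (11 / 2 / x ^ 2)) := by
    calc T ≤ ∫⁻ y in Ici x, ((Iio (x/2)).indicator (fun _ => ENNReal.ofReal (ph x * ((-x) / 2))) y
              + ENNReal.ofReal (ph x * (5 / x ^ 2))) ∂γ := by
          refine lintegral_mono fun y => ?_
          by_cases hy : y < x / 2
          · rw [indicator_of_mem (show y ∈ Iio (x/2) from hy)]
            exact (inner1 hx hy).trans le_self_add
          · rw [indicator_of_notMem (show y ∉ Iio (x/2) from hy), zero_add]
            exact inner2 hx (not_lt.1 hy) hB1 hB2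
      _ ≤ ∫⁻ y, ((Iio (x/2)).indicator (fun _ => ENNReal.ofReal (ph x * ((-x) / 2))) y
              + ENNReal.ofReal (ph x * (5 / x ^ 2))) ∂γ := setLIntegral_le_lintegral _ _
      _ = ENNReal.ofReal (ph x * ((-x) / 2)) * ENNReal.ofReal (gF (x/2)) +
            ENNReal.ofReal (ph x * (5 / x ^ 2)) := by
          rw [lintegral_add_right _ measurable_const, lintegral_indicator_const measurableSet_Iio,
            gauss_Iio]
          simp
      _ ≤ _ := by
          have := ph_pos x
          have := gF_pos (x / 2)
          rw [← ENNReal.ofReal_mul (by positivity), ← ENNReal.ofReal_add (by positivity) (by positivity)]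
          apply ENNReal.ofReal_le_ofReal
          calc _ ≤ ph x * ((-x) / 2) * (1 / (-x) ^ 3) + ph x * (5 / x ^ 2) := by gcongr
            _ = _ := by
              have := hx.ne
              field_simp
              ring
  have hK : ∫⁻ y in Ici x, ∫⁻ z in Ici x, ENNReal.ofReal (ker x y z) ∂γ ∂γ ≤ T + T := by
    have hsplit : ∀ y ∈ Ici x, ∫⁻ z in Ici x, ENNReal.ofReal (ker x y z) ∂γ ≤
        ∫⁻ z in Icc x y, ENNReal.ofReal (ker x y z) ∂γ +
        ∫⁻ z in Ici x, (if y ≤ z then ENNReal.ofReal (ker x y z) else 0) ∂γ := by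
      intro y hy
      rw [← lintegral_indicator measurableSet_Icc, ← lintegral_indicator measurableSet_Ici,
        ← lintegral_indicator measurableSet_Ici, ← lintegral_add_left]
      · refine lintegral_mono fun z => ?_
        by_cases h1 : x ≤ z <;> by_cases h2 : z ≤ y <;> by_cases h3 : y ≤ z <;>
          simp [indicator, h1, h2, h3]
        exact absurd (le_total z y) (by simp [h2, h3])
      · exact Measurable.indicator (ker_meas x y).ennreal_ofReal measurableSet_Icc
    refine (setLIntegral_mono' measurableSet_Ici hsplit).trans ?_
    have m2 : Measurable (fun q : ℝ × ℝ => if q.1 ≤ q.2 then ENNReal.ofReal (ker x q.1 q.2) else 0) :=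
      Measurable.ite (measurableSet_le measurable_fst measurable_snd) kmeas measurable_const
    rw [lintegral_add_right _ (Measurable.lintegral_prod_right' (f := fun q : ℝ × ℝ =>
      if q.1 ≤ q.2 then ENNReal.ofReal (ker x q.1 q.2) else 0) m2)]
    gcongr
    rw [lintegral_lintegral_swap m2.aemeasurable]
    refine (setLIntegral_mono' measurableSet_Ici fun z hz => ?_)
    rw [← lintegral_indicator measurableSet_Icc, ← lintegral_indicator measurableSet_Ici]
    refine lintegral_mono fun y => ?_
    by_cases h1 : x ≤ y <;> by_cases h3 : y ≤ z <;>
          simp [indicator, h1, h3, ker, mul_comm]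
  calc Hf x ≤ ∫⁻ y in Ici x, ∫⁻ z in Ici x, ENNReal.ofReal (pp x) * ENNReal.ofReal (ker x y z) ∂γ ∂γ := by
        refine lintegral_mono fun y => lintegral_mono fun z => ?_
        rw [← ENNReal.ofReal_mul hp.le]
        apply ENNReal.ofReal_le_ofReal
        refine (pp_shift (by positivity)).trans (le_of_eq ?_)
        rw [ker]; congr 2; ring
    _ = ENNReal.ofReal (pp x) * ∫⁻ y in Ici x, ∫⁻ z in Ici x, ENNReal.ofReal (ker x y z) ∂γ ∂γ := by
        rw [← lintegral_const_mul' _ _ (by simp)]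
        congr 1; funext y
        rw [← lintegral_const_mul' _ _ (by simp)]
    _ ≤ ENNReal.ofReal (pp x) * (ENNReal.ofReal (ph x * (11 / 2 / x ^ 2)) +
          ENNReal.ofReal (ph x * (11 / 2 / x ^ 2))) := by
        gcongr
        exact hK.trans (add_le_add hTle hTle)
    _ ≤ _ := by
        have hph := ph_pos x
        have hg := gF_pos x
        rw [← ENNReal.ofReal_add (by positivity) (by positivity), ← ENNReal.ofReal_mul hp.le]
        apply ENNReal.ofReal_le_ofReal
        calc _ = pp x * (ph x * (11 / x ^ 2)) := by ring
          _ ≤ (4 * (-x) * gF x ^ 2) * ((2 * (-x) * gF x) * (11 / x ^ 2)) := by gcongr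
          _ = _ := by
            have := hx.ne
            field_simp
            norm_num

lemma Hf_bound : ∃ C, 0 < C ∧ ∀ x, (Hf x).toReal ≤ C * gF x ^ 3 := by
  refine globalize _ (fun x => ?_) 3 88 ?_
  · exact ENNReal.toReal_le_of_le_ofReal zero_le_one (by simpa using Hf_le_one x)
  · filter_upwards [Hf_ev] with x hx
    have := gF_pos x
    exact ENNReal.toReal_le_of_le_ofReal (by positivity) hx

end GOEAux

namespace GOEAux
open Set Topology
open scoped ENNReal

/-- edges -/
abbrev Edge (n : ℕ) := {p : Fin n × Fin n // p.1 < p.2}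

def edge {n : ℕ} (j k : Fin n) (h : j ≠ k) : Edge n :=
  if h' : j < k then ⟨(j, k), h'⟩ else ⟨(k, j), lt_of_le_of_ne (not_lt.mp h') (Ne.symm h)⟩

lemma goe_diag {n : ℕ} (d : Fin n → ℝ) (o : Edge n → ℝ) (i : Fin n) :
    goeMatrix n d o i i = d i := by simp [goeMatrix]

lemma goe_off {n : ℕ} (d : Fin n → ℝ) (o : Edge n → ℝ) (j k : Fin n) (h : j ≠ k) :
    goeMatrix n d o j k = o (edge j k h) := by
  unfold goeMatrix edge
  rw [dif_neg h]
  split_ifs <;> rfl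

lemma edge_comm {n : ℕ} (j k : Fin n) (h : j ≠ k) : edge j k h = edge k j h.symm := by
  unfold edge
  rcases lt_or_gt_of_ne h with h1 | h1
  · rw [dif_pos h1, dif_neg h1.not_gt]
  · rw [dif_neg h1.not_gt, dif_pos h1]

lemma edge_inj {n : ℕ} {i j k : Fin n} (hj : i ≠ j) (hk : i ≠ k) (h : edge i j hj = edge i k hk) :
    j = k := by
  unfold edge at h
  split_ifs at h <;> simp only [Subtype.mk.injEq, Prod.mk.injEq] at h <;> grind

lemma goe_symm {n : ℕ} (d : Fin n → ℝ) (o : Edge n → ℝ) (j k : Fin n) :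
    goeMatrix n d o j k = goeMatrix n d o k j := by
  by_cases h : j = k
  · rw [h]
  · rw [goe_off _ _ _ _ h, goe_off _ _ _ _ (Ne.symm h), edge_comm]

lemma quad_eq {n : ℕ} (Q : Matrix (Fin n) (Fin n) ℝ) (x : Fin n → ℝ) :
    x ⬝ᵥ Q.mulVec x = ∑ j, ∑ k, Q j k * x j * x k := by
  simp only [dotProduct, mulVec, Finset.mul_sum]
  refine Finset.sum_congr rfl fun j _ => Finset.sum_congr rfl fun k _ => by ring

open Classical in
lemma det_upper {n : ℕ} (Q : Matrix (Fin n) (Fin n) ℝ) (hsym : ∀ j k, Q j k = Q k j) (m : ℝ)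
    (hd : ∀ i, m ≤ Q i i)
    (h1 : ∀ j k, j ≠ k → m - 1 / 2 * Real.sqrt ((Q j j - m) * (Q k k - m)) ≤ Q j k)
    (h2 : ∀ j, (Finset.univ.filter fun k => j ≠ k ∧ Q j k < m).card ≤ 2)
    (x : Fin n → ℝ) (hx : x ∈ stdSimplex ℝ (Fin n)) : m ≤ x ⬝ᵥ Q.mulVec x := by
  obtain ⟨hx0, hx1⟩ := hx
  have hm : m = ∑ j, ∑ k, m * x j * x k := by
    have : ∑ j, ∑ k, m * x j * x k = m * (∑ j, x j) * (∑ k, x k) := by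
      rw [mul_assoc, Finset.sum_mul_sum, Finset.mul_sum]
      refine Finset.sum_congr rfl fun j _ => ?_
      rw [Finset.mul_sum]
      refine Finset.sum_congr rfl fun k _ => by ring
    rw [this, hx1]; ring
  rw [quad_eq]
  set w : Fin n → ℝ := fun j => (Q j j - m) * x j ^ 2 with hw
  have hw0 : ∀ j, 0 ≤ w j := fun j => mul_nonneg (by linarith [hd j]) (sq_nonneg _)
  have key : ∀ j k, (if j = k then w j else 0) - (if j ≠ k ∧ Q j k < m then 1/4 * w j else 0)
      - (if j ≠ k ∧ Q j k < m then 1/4 * w k else 0) ≤ Q j k * x j * x k - m * x j * x k := by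
    intro j k
    by_cases hjk : j = k
    · subst hjk
      simp only [hw, if_true, ne_eq, not_true_eq_false, false_and, if_false]
      apply le_of_eq; ring
    · by_cases hn : Q j k < m
      · simp only [hjk, if_false, ne_eq, not_false_eq_true, true_and, hn, if_true]
        have a1 := h1 j k hjk
        have hDj : 0 ≤ Q j j - m := by linarith [hd j]
        have hDk : 0 ≤ Q k k - m := by linarith [hd k]
        rw [Real.sqrt_mul hDj] at a1
        have e1 := Real.sq_sqrt hDj
        have e2 := Real.sq_sqrt hDk
        have wj : w j = (Real.sqrt (Q j j - m) * x j) ^ 2 := by rw [mul_pow, e1]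
        have wk : w k = (Real.sqrt (Q k k - m) * x k) ^ 2 := by rw [mul_pow, e2]
        rw [wj, wk]
        have hxx : 0 ≤ x j * x k := mul_nonneg (hx0 j) (hx0 k)
        have a2 := mul_le_mul_of_nonneg_right a1 hxx
        nlinarith [sq_nonneg (Real.sqrt (Q j j - m) * x j - Real.sqrt (Q k k - m) * x k)]
      · simp only [hjk, if_false, hn, and_false, sub_zero]
        have hxx : 0 ≤ x j * x k := mul_nonneg (hx0 j) (hx0 k)
        nlinarith [not_lt.1 hn]
  have hs := Finset.sum_le_sum fun j (_ : j ∈ Finset.univ) =>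
    Finset.sum_le_sum fun k (_ : k ∈ Finset.univ) => key j k
  simp only [Finset.sum_sub_distrib] at hs
  rw [← hm] at hs
  have s1 : ∑ j, ∑ k, (if j = k then w j else 0) = ∑ j, w j := by simp
  have s2 : ∀ j, ∑ k, (if j ≠ k ∧ Q j k < m then 1/4 * w j else 0) ≤ 1/2 * w j := by
    intro j
    rw [← Finset.sum_filter, Finset.sum_const, nsmul_eq_mul]
    have : ((Finset.univ.filter fun k => j ≠ k ∧ Q j k < m).card : ℝ) ≤ 2 := by exact_mod_cast h2 j
    nlinarith [hw0 j]
  have s3 : ∑ j, ∑ k, (if j ≠ k ∧ Q j k < m then 1/4 * w k else 0) =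
      ∑ j, ∑ k, (if j ≠ k ∧ Q j k < m then 1/4 * w j else 0) := by
    rw [Finset.sum_comm]
    refine Finset.sum_congr rfl fun j _ => Finset.sum_congr rfl fun k _ => ?_
    rw [hsym k j]; simp only [ne_comm]
  have s4 := Finset.sum_le_sum fun j (_ : j ∈ Finset.univ) => s2 j
  rw [← Finset.mul_sum] at s4
  rw [s1, s3] at hs
  linarith

lemma two_sum {n : ℕ} (q : Fin n → Fin n → ℝ) (i k : Fin n) (s t : ℝ) :
    ∑ j, ∑ l, q j l * ((if j = i then s else 0) + (if j = k then t else 0)) *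
        ((if l = i then s else 0) + (if l = k then t else 0)) =
        s * (s * q i i + t * q i k) + t * (s * q k i + t * q k k) := by
  have inner : ∀ j, ∑ l, q j l * ((if j = i then s else 0) + (if j = k then t else 0)) *
        ((if l = i then s else 0) + (if l = k then t else 0)) =
      (if j = i then s * (s * q j i + t * q j k) else 0) +
      (if j = k then t * (s * q j i + t * q j k) else 0) := by
    intro j
    have : ∀ c : ℝ, ∑ l, q j l * c * ((if l = i then s else 0) + (if l = k then t else 0)) =
        q j i * c * s + q j k * c * t := by
      intro c
      simp only [mul_add, Finset.sum_add_distrib, mul_ite, mul_zero, Finset.sum_ite_eq',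
        Finset.mem_univ, if_true]
    rw [this]
    split_ifs <;> ring
  simp_rw [inner, Finset.sum_add_distrib, Finset.sum_ite_eq', Finset.mem_univ, if_true]

lemma det_lower {n : ℕ} (Q : Matrix (Fin n) (Fin n) ℝ) (hsym : ∀ j k, Q j k = Q k j) (i k : Fin n)
    (hmin : Q i i ≤ Q k k) (h : Q i k < Q i i) :
    ∃ x ∈ stdSimplex ℝ (Fin n), x ⬝ᵥ Q.mulVec x < Q i i := by
  set a := Q i i with ha
  set b := Q k k with hb
  set c := Q i k with hc
  have hpos : 0 < a + b - 2 * c := by linarith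
  set ε := (a - c) / (a + b - 2 * c) with hε
  have hε0 : 0 < ε := div_pos (by linarith) hpos
  have hε1 : ε ≤ 1 := by rw [hε, div_le_one hpos]; linarith
  have hεm : ε * (a + b - 2 * c) = a - c := by rw [hε]; exact div_mul_cancel₀ _ hpos.ne'
  refine ⟨fun j => (if j = i then 1 - ε else 0) + (if j = k then ε else 0), ⟨fun j => ?_, ?_⟩, ?_⟩
  · have : 0 ≤ 1 - ε := by linarith
    positivity
  · rw [Finset.sum_add_distrib]; simp
  · rw [quad_eq]
    have : ∑ j, ∑ l, Q j l * ((if j = i then 1 - ε else 0) + (if j = k then ε else 0)) *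
        ((if l = i then 1 - ε else 0) + (if l = k then ε else 0)) =
        (1 - ε) ^ 2 * a + 2 * ε * (1 - ε) * c + ε ^ 2 * b := by
      rw [two_sum (fun j l => Q j l) i k (1 - ε) ε, hsym k i, ← ha, ← hb, ← hc]; ring
    rw [this]
    nlinarith

/-- eta -/
lemma eta_Iio (t : ℝ) : gaussianReal 0 (1 / 2) (Iio t) = ENNReal.ofReal (pp t) := by
  have h := gaussianReal_map_const_mul (μ := 0) (v := 1/2) (Real.sqrt 2)
  have e : NNReal.mk (Real.sqrt 2 ^ 2) (sq_nonneg _) * (1 / 2) = 1 := by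
    ext; simp
  rw [e, mul_zero] at h
  rw [pp, ← gauss_Iio, ← h, Measure.map_apply (by fun_prop) measurableSet_Iio]
  congr 1
  ext x
  simp

lemma eta_Ici (t : ℝ) : gaussianReal 0 (1 / 2) (Ici t) = ENNReal.ofReal (1 - pp t) := by
  rw [← compl_Iio, prob_compl_eq_one_sub measurableSet_Iio, eta_Iio,
    ENNReal.ofReal_sub _ (pp_pos t).le, ENNReal.ofReal_one]

lemma gauss_Ici (t : ℝ) : gaussianReal 0 1 (Ici t) = ENNReal.ofReal (1 - gF t) := by
  rw [← compl_Iio, prob_compl_eq_one_sub measurableSet_Iio, gauss_Iio,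
    ENNReal.ofReal_sub _ (gF_pos t).le, ENNReal.ofReal_one]

lemma gauss_Ioi (t : ℝ) : gaussianReal 0 1 (Ioi t) = ENNReal.ofReal (1 - gF t) := by
  have := nullSingletonClass_gaussianReal (μ := 0) (one_ne_zero (α := NNReal))
  rw [← gauss_Ici]
  exact measure_congr Ioi_ae_eq_Ici

end GOEAux

namespace GOEAux
open Set Topology
open scoped ENNReal

lemma prod_sect {α β : Type*} [MeasurableSpace α] [MeasurableSpace β] (D : Measure α)
    (O : Measure β) [SFinite O] (S : Set α) (hS : MeasurableSet S) (A : α → Set β)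
    (hA : MeasurableSet {p : α × β | p.2 ∈ A p.1}) :
    (D.prod O) {p | p.1 ∈ S ∧ p.2 ∈ A p.1} = ∫⁻ d in S, O (A d) ∂D := by
  have hm : MeasurableSet {p : α × β | p.1 ∈ S ∧ p.2 ∈ A p.1} := (measurable_fst hS).inter hA
  rw [Measure.prod_apply hm, ← lintegral_indicator hS]
  congr 1
  ext d
  by_cases hd : d ∈ S
  · rw [indicator_of_mem hd]
    congr 1
    ext o
    simp [hd]
  · rw [indicator_of_notMem hd]
    have : (Prod.mk d ⁻¹' {p : α × β | p.1 ∈ S ∧ p.2 ∈ A p.1}) = ∅ := by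
      ext o
      simp [hd]
    rw [this, measure_empty]

section
variable {ι : Type*} [Fintype ι]

lemma pi_all (s : Finset ι) (B : Set ℝ) :
    (Measure.pi fun _ : ι => gaussianReal 0 (1 / 2)) {o | ∀ e ∈ s, o e ∈ B} =
      gaussianReal 0 (1 / 2) B ^ s.card := by
  classical
  have : {o : ι → ℝ | ∀ e ∈ s, o e ∈ B} = Set.univ.pi (fun e => if e ∈ s then B else Set.univ) := by
    ext o
    simp only [mem_ofPred_eq, Set.mem_pi, Set.mem_univ, true_implies]
    refine forall_congr' fun e => ?_
    by_cases he : e ∈ s <;> simp [he]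
  rw [this, Measure.pi_pi]
  have : ∀ e, gaussianReal 0 (1 / 2) (if e ∈ s then B else Set.univ) =
      if e ∈ s then gaussianReal 0 (1 / 2) B else 1 := by
    intro e; split_ifs <;> simp
  simp_rw [this]
  rw [Finset.prod_ite_mem, Finset.univ_inter, Finset.prod_const]

lemma prod_all {α : Type*} [MeasurableSpace α] (D : Measure α)
    (s : Finset ι) (S : Set α) (hS : MeasurableSet S) (t : α → ℝ) (ht : Measurable t) :
    (D.prod (Measure.pi fun _ : ι => gaussianReal 0 (1 / 2)))
      {p | p.1 ∈ S ∧ ∀ e ∈ s, p.2 e < t p.1} =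
      ∫⁻ d in S, ENNReal.ofReal (pp (t d)) ^ s.card ∂D := by
  have := prod_sect D (Measure.pi fun _ : ι => gaussianReal 0 (1 / 2)) S hS
    (fun d => {o | ∀ e ∈ s, o e ∈ Iio (t d)}) ?_
  · simp_rw [pi_all, eta_Iio] at this
    exact this
  · have : {p : α × (ι → ℝ) | p.2 ∈ {o : ι → ℝ | ∀ e ∈ s, o e ∈ Iio (t p.1)}} =
      ⋂ e ∈ s, {p | p.2 e < t p.1} := by ext; simp
    rw [this]
    exact Finset.measurableSet_biInter _ fun e _ => measurableSet_lt (by fun_prop) (by fun_prop)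

lemma prod_ex {α : Type*} [MeasurableSpace α] (D : Measure α)
    (s : Finset ι) (S : Set α) (hS : MeasurableSet S) (t : α → ℝ) (ht : Measurable t) :
    (D.prod (Measure.pi fun _ : ι => gaussianReal 0 (1 / 2)))
      {p | p.1 ∈ S ∧ ∃ e ∈ s, p.2 e < t p.1} =
      ∫⁻ d in S, ENNReal.ofReal (1 - (1 - pp (t d)) ^ s.card) ∂D := by
  have hh : ∀ d, {o : ι → ℝ | ∃ e ∈ s, o e < t d} = {o : ι → ℝ | ∀ e ∈ s, o e ∈ Ici (t d)}ᶜ := by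
    intro d; ext o; simp
  have hm : ∀ d, MeasurableSet {o : ι → ℝ | ∀ e ∈ s, o e ∈ Ici (t d)} := by
    intro d
    have : {o : ι → ℝ | ∀ e ∈ s, o e ∈ Ici (t d)} = ⋂ e ∈ s, {o | t d ≤ o e} := by ext; simp
    rw [this]
    exact Finset.measurableSet_biInter _ fun e _ => measurableSet_le (by fun_prop) (by fun_prop)
  have := prod_sect D (Measure.pi fun _ : ι => gaussianReal 0 (1 / 2)) S hS
    (fun d => {o | ∃ e ∈ s, o e < t d}) ?_
  · have h2 : ∀ d, (Measure.pi fun _ : ι => gaussianReal 0 (1 / 2))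
        {o : ι → ℝ | ∃ e ∈ s, o e < t d} = ENNReal.ofReal (1 - (1 - pp (t d)) ^ s.card) := by
      intro d
      have h0 : 0 ≤ 1 - pp (t d) := by linarith [pp_lt_one (t d)]
      rw [hh, prob_compl_eq_one_sub (hm d), pi_all, eta_Ici,
        ENNReal.ofReal_sub _ (pow_nonneg h0 _), ENNReal.ofReal_one, ENNReal.ofReal_pow h0]
    simp_rw [h2] at this
    exact this
  · have : {p : α × (ι → ℝ) | p.2 ∈ {o : ι → ℝ | ∃ e ∈ s, o e < t p.1}} =
      ⋃ e ∈ s, {p | p.2 e < t p.1} := by ext; simp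
    rw [this]
    exact Finset.measurableSet_biUnion _ fun e _ => measurableSet_lt (by fun_prop) (by fun_prop)
end

lemma peel {N : ℕ} (ν : Measure ℝ) [SigmaFinite ν] (i : Fin (N + 1)) (f : (Fin (N + 1) → ℝ) → ℝ≥0∞)
    (hf : Measurable f) :
    ∫⁻ d, f d ∂(Measure.pi fun _ : Fin (N + 1) => ν) =
      ∫⁻ x, ∫⁻ d', f (i.insertNth x d') ∂(Measure.pi fun _ : Fin N => ν) ∂ν := by
  have h := (measurePreserving_piFinSuccAbove (fun _ : Fin (N + 1) => ν) i).symm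
  rw [← h.lintegral_comp hf, lintegral_prod]
  · rfl
  · exact (hf.comp (MeasurableEquiv.measurable _)).aemeasurable

lemma I1 {N : ℕ} (i : Fin (N + 1)) (s : ℝ → Set ℝ) (hs : MeasurableSet {p : ℝ × ℝ | p.2 ∈ s p.1})
    (f : ℝ → ℝ≥0∞) (hf : Measurable f) :
    ∫⁻ d in {d | ∀ l, d (i.succAbove l) ∈ s (d i)}, f (d i)
      ∂(Measure.pi fun _ : Fin (N + 1) => gaussianReal 0 1) =
    ∫⁻ x, gaussianReal 0 1 (s x) ^ N * f x ∂(gaussianReal 0 1) := by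
  have hm : MeasurableSet {d : Fin (N + 1) → ℝ | ∀ l, d (i.succAbove l) ∈ s (d i)} := by
    have : {d : Fin (N + 1) → ℝ | ∀ l, d (i.succAbove l) ∈ s (d i)} =
      ⋂ l, (fun d : Fin (N + 1) → ℝ => (d i, d (i.succAbove l))) ⁻¹' {p : ℝ × ℝ | p.2 ∈ s p.1} := by
      ext; simp
    rw [this]
    refine MeasurableSet.iInter fun l => ?_
    have : Measurable (fun d : Fin (N + 1) → ℝ => (d i, d (i.succAbove l))) := by fun_prop
    exact this hs
  have hf2 : Measurable (fun d : Fin (N + 1) → ℝ => f (d i)) := hf.comp (measurable_pi_apply i)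
  rw [← lintegral_indicator hm, peel _ i _ (hf2.indicator hm)]
  congr 1
  ext x
  have hsx : MeasurableSet (s x) := (measurable_const.prodMk measurable_id : Measurable fun y : ℝ => (x, y)) hs
  have e : ∀ d' : Fin N → ℝ, ({d : Fin (N + 1) → ℝ | ∀ l, d (i.succAbove l) ∈ s (d i)}.indicator
      (fun d => f (d i)) (i.insertNth x d')) =
      (Set.univ.pi fun _ : Fin N => s x).indicator (fun _ => f x) d' := by
    intro d'
    have h : ((i.insertNth x d' : Fin (N + 1) → ℝ) ∈
        {d : Fin (N + 1) → ℝ | ∀ l, d (i.succAbove l) ∈ s (d i)}) ↔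
        d' ∈ Set.univ.pi fun _ : Fin N => s x := by
      simp only [mem_ofPred_eq, Set.mem_pi, Set.mem_univ, true_implies, Fin.insertNth_apply_same,
        Fin.insertNth_apply_succAbove]
    by_cases h' : d' ∈ Set.univ.pi fun _ : Fin N => s x
    · rw [indicator_of_mem h', indicator_of_mem (h.2 h'), Fin.insertNth_apply_same]
    · rw [indicator_of_notMem h', indicator_of_notMem (fun hh => h' (h.1 hh))]
  simp_rw [e]
  rw [lintegral_indicator (MeasurableSet.univ_pi fun _ => hsx), lintegral_const,
    Measure.restrict_apply_univ, Measure.pi_pi]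
  simp [mul_comm]

lemma J1 {M : ℕ} (ν : Measure ℝ) [IsFiniteMeasure ν] (k : Fin (M + 1)) (g : ℝ → ℝ≥0∞)
    (hg : Measurable g) :
    ∫⁻ d, g (d k) ∂(Measure.pi fun _ : Fin (M + 1) => ν) = ν univ ^ M * ∫⁻ z, g z ∂ν := by
  have hg2 : Measurable (fun d : Fin (M + 1) → ℝ => g (d k)) := hg.comp (measurable_pi_apply k)
  rw [peel ν k _ hg2]
  simp only [Fin.insertNth_apply_same, lintegral_const, Measure.pi_univ, Finset.prod_const,
    Finset.card_univ, Fintype.card_fin]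
  rw [lintegral_mul_const _ hg, mul_comm]

lemma J2 {M : ℕ} (ν : Measure ℝ) [IsFiniteMeasure ν] (j k : Fin (M + 2)) (hjk : k ≠ j)
    (g : ℝ → ℝ → ℝ≥0∞) (hg : Measurable (Function.uncurry g)) :
    ∫⁻ d, g (d j) (d k) ∂(Measure.pi fun _ : Fin (M + 2) => ν) =
      ν univ ^ M * ∫⁻ y, ∫⁻ z, g y z ∂ν ∂ν := by
  have hmm : Measurable (fun d : Fin (M + 2) → ℝ => (d j, d k)) := by fun_prop
  have hg2 : Measurable (fun d : Fin (M + 2) → ℝ => g (d j) (d k)) := hg.comp hmm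
  rw [peel ν j _ hg2]
  obtain ⟨k', rfl⟩ := Fin.exists_succAbove_eq hjk
  simp only [Fin.insertNth_apply_same, Fin.insertNth_apply_succAbove]
  have hgy : ∀ y, Measurable (g y) := fun y => hg.comp (measurable_const.prodMk measurable_id)
  simp_rw [fun y => J1 ν k' (g y) (hgy y)]
  have hg3 : Measurable (fun y => ∫⁻ z, g y z ∂ν) := hg.lintegral_prod_right'
  rw [lintegral_const_mul _ hg3]

lemma I3 {M : ℕ} (i j k : Fin (M + 3)) (hj : j ≠ i) (hk : k ≠ i) (hjk : k ≠ j)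
    (g : ℝ → ℝ → ℝ → ℝ≥0∞) (hg : Measurable (fun p : ℝ × ℝ × ℝ => g p.1 p.2.1 p.2.2)) :
    ∫⁻ d in {d | ∀ l, d i ≤ d l}, g (d i) (d j) (d k)
      ∂(Measure.pi fun _ : Fin (M + 3) => gaussianReal 0 1) =
    ∫⁻ x, gaussianReal 0 1 (Ici x) ^ M *
      ∫⁻ y in Ici x, ∫⁻ z in Ici x, g x y z ∂(gaussianReal 0 1) ∂(gaussianReal 0 1)
        ∂(gaussianReal 0 1) := by
  have hm : MeasurableSet {d : Fin (M + 3) → ℝ | ∀ l, d i ≤ d l} := by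
    have : {d : Fin (M + 3) → ℝ | ∀ l, d i ≤ d l} = ⋂ l, {d | d i ≤ d l} := by ext; simp
    rw [this]
    exact MeasurableSet.iInter fun l => measurableSet_le (by fun_prop) (by fun_prop)
  have hmm : Measurable (fun d : Fin (M + 3) → ℝ => (d i, d j, d k)) := by fun_prop
  have hg2 : Measurable (fun d : Fin (M + 3) → ℝ => g (d i) (d j) (d k)) := hg.comp hmm
  rw [← lintegral_indicator hm, peel _ i _ (hg2.indicator hm)]
  obtain ⟨j', rfl⟩ := Fin.exists_succAbove_eq hj
  obtain ⟨k', rfl⟩ := Fin.exists_succAbove_eq hk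
  congr 1
  ext x
  have e : ∀ d' : Fin (M + 2) → ℝ, ({d : Fin (M + 3) → ℝ | ∀ l, d i ≤ d l}.indicator
      (fun d => g (d i) (d (i.succAbove j')) (d (i.succAbove k'))) (i.insertNth x d')) =
      (Set.univ.pi fun _ : Fin (M + 2) => Ici x).indicator (fun d' => g x (d' j') (d' k')) d' := by
    intro d'
    have h : ((i.insertNth x d' : Fin (M + 3) → ℝ) ∈
        {d : Fin (M + 3) → ℝ | ∀ l, d i ≤ d l}) ↔
        d' ∈ Set.univ.pi fun _ : Fin (M + 2) => Ici x := by
      simp only [mem_ofPred_eq, Set.mem_pi, Set.mem_univ, true_implies, Fin.insertNth_apply_same,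
        Fin.insertNth_apply_succAbove, Fin.forall_iff_succAbove i, le_refl, true_and, mem_Ici]
    by_cases h' : d' ∈ Set.univ.pi fun _ : Fin (M + 2) => Ici x
    · rw [indicator_of_mem h', indicator_of_mem (h.2 h'), Fin.insertNth_apply_same,
        Fin.insertNth_apply_succAbove, Fin.insertNth_apply_succAbove]
    · rw [indicator_of_notMem h', indicator_of_notMem (fun hh => h' (h.1 hh))]
  simp_rw [e]
  rw [lintegral_indicator (MeasurableSet.univ_pi fun _ => measurableSet_Ici), Measure.restrict_pi_pi,
    J2 _ j' k' (fun h => hjk (by rw [h])) (g x)]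
  · rw [Measure.restrict_apply_univ]
  · have : Measurable (fun p : ℝ × ℝ => (x, p.1, p.2)) := by fun_prop
    exact hg.comp this

end GOEAux

namespace GOEAux
open Set Topology
open scoped ENNReal

/-- underlying product measure -/
noncomputable def mun (n : ℕ) : Measure ((Fin n → ℝ) × (Edge n → ℝ)) :=
  (Measure.pi fun _ : Fin n => gaussianReal 0 1).prod
      (Measure.pi fun _ : Edge n => gaussianReal 0 (1 / 2))

instance (n : ℕ) : IsProbabilityMeasure (mun n) := by unfold mun; infer_instance

/-- the event on matrices -/
def evM (n : ℕ) : Set (Matrix (Fin n) (Fin n) ℝ) :=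
  {Q | ∃ x ∈ stdSimplex ℝ (Fin n), x ⬝ᵥ Q.mulVec x < ⨅ i : Fin n, Q i i}

def ev (n : ℕ) : Set ((Fin n → ℝ) × (Edge n → ℝ)) :=
  {p | ∃ x ∈ stdSimplex ℝ (Fin n), ∀ i, x ⬝ᵥ (goeMatrix n p.1 p.2).mulVec x < p.1 i}

lemma lt_ciInf_fin {n : ℕ} (f : Fin (n + 1) → ℝ) (a : ℝ) : a < ⨅ i, f i ↔ ∀ i, a < f i := by
  constructor
  · intro h i
    exact lt_of_lt_of_le h (ciInf_le (Set.finite_range f).bddBelow i)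
  · intro h
    obtain ⟨i, hi⟩ := exists_eq_ciInf_of_finite (f := f)
    rw [← hi]; exact h i

instance (n : ℕ) : OpensMeasurableSpace (Matrix (Fin n) (Fin n) ℝ) :=
  inferInstanceAs (OpensMeasurableSpace (Fin n → Fin n → ℝ))

lemma evM_meas (N : ℕ) : MeasurableSet (evM (N + 1)) := by
  have : evM (N + 1) = ⋃ x ∈ stdSimplex ℝ (Fin (N + 1)), ⋂ i : Fin (N + 1),
      {Q : Matrix (Fin (N + 1)) (Fin (N + 1)) ℝ | x ⬝ᵥ Q.mulVec x < Q i i} := by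
    ext Q
    simp only [evM, mem_ofPred_eq, lt_ciInf_fin, mem_iUnion, mem_iInter, exists_prop]
  rw [this]
  refine IsOpen.measurableSet (isOpen_biUnion fun x _ => isOpen_iInter_of_finite fun i => ?_)
  refine isOpen_lt ?_ ?_
  · exact continuous_const.dotProduct (continuous_id.matrix_mulVec continuous_const)
  · exact continuous_id.matrix_elem i i

lemma goe_meas (n : ℕ) : Measurable (fun dq : (Fin n → ℝ) × (Edge n → ℝ) =>
    goeMatrix n dq.1 dq.2) := by
  refine measurable_pi_iff.2 fun i => measurable_pi_iff.2 fun j => ?_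
  by_cases h : i = j
  · subst h
    simp_rw [goe_diag]
    fun_prop
  · simp_rw [fun dq : (Fin n → ℝ) × (Edge n → ℝ) => goe_off dq.1 dq.2 i j h]
    fun_prop

lemma goe_ev (N : ℕ) : goeMeasure (N + 1) {Q | ∃ x ∈ stdSimplex ℝ (Fin (N + 1)),
              x ⬝ᵥ Q.mulVec x < ⨅ i : Fin (N + 1), Q i i} = mun (N + 1) (ev (N + 1)) := by
  change goeMeasure (N + 1) (evM (N + 1)) = _
  rw [goeMeasure, Measure.map_apply (goe_meas _) (evM_meas N)]
  unfold mun
  congr 1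
  ext p
  simp only [evM, ev, mem_preimage, mem_ofPred_eq, lt_ciInf_fin, goe_diag]

/-- bad events -/
def evA {n : ℕ} (i k : Fin n) : Set ((Fin n → ℝ) × (Edge n → ℝ)) :=
  {p | (∀ l, p.1 i ≤ p.1 l) ∧ ∃ h : i ≠ k, p.2 (edge i k h) < p.1 i}

def evB {n : ℕ} (i j k : Fin n) : Set ((Fin n → ℝ) × (Edge n → ℝ)) :=
  {p | (∀ l, p.1 i ≤ p.1 l) ∧ ∃ h : j ≠ k, j ≠ i ∧ k ≠ i ∧
    p.2 (edge j k h) < p.1 i - 1 / 2 * Real.sqrt ((p.1 j - p.1 i) * (p.1 k - p.1 i))}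

def evC {n : ℕ} (i j k1 k2 k3 : Fin n) : Set ((Fin n → ℝ) × (Edge n → ℝ)) :=
  {p | (∀ l, p.1 i ≤ p.1 l) ∧ (k1 ≠ k2 ∧ k1 ≠ k3 ∧ k2 ≠ k3) ∧
    ∃ (h1 : j ≠ k1) (h2 : j ≠ k2) (h3 : j ≠ k3), p.2 (edge j k1 h1) < p.1 i ∧
      p.2 (edge j k2 h2) < p.1 i ∧ p.2 (edge j k3 h3) < p.1 i}

lemma ev_sub (N : ℕ) : ev (N + 1) ⊆ (⋃ q : Fin (N + 1) × Fin (N + 1), evA q.1 q.2) ∪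
    ((⋃ q : Fin (N + 1) × Fin (N + 1) × Fin (N + 1), evB q.1 q.2.1 q.2.2) ∪
    (⋃ q : Fin (N + 1) × Fin (N + 1) × Fin (N + 1) × Fin (N + 1) × Fin (N + 1),
      evC q.1 q.2.1 q.2.2.1 q.2.2.2.1 q.2.2.2.2)) := by
  classical
  rintro ⟨d, o⟩ ⟨x, hx, hlt⟩
  by_contra hnot
  simp only [mem_union, mem_iUnion, Prod.exists, not_or, not_exists] at hnot
  obtain ⟨hA, hB, hC⟩ := hnot
  obtain ⟨i, hi⟩ := Finite.exists_min d
  have hA' : ∀ k (h : i ≠ k), d i ≤ o (edge i k h) := by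
    intro k h
    by_contra hc
    exact hA i k ⟨hi, h, not_le.1 hc⟩
  have := det_upper (goeMatrix (N + 1) d o) (goe_symm d o) (d i) (fun l => by rw [goe_diag]; exact hi l)
    ?_ ?_ x hx
  · exact absurd (hlt i) (not_lt.2 this)
  · intro j k hjk
    rw [goe_diag, goe_diag, goe_off _ _ _ _ hjk]
    by_cases hji : j = i
    · subst hji
      simpa using hA' k hjk
    · by_cases hki : k = i
      · subst hki
        rw [edge_comm]
        simpa using hA' j hjk.symm
      · by_contra hc
        exact hB i j k ⟨hi, hjk, hji, hki, not_le.1 hc⟩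
  · intro j
    by_contra hc
    obtain ⟨a, ha, b, hb, c, hc, hab, hac, hbc⟩ := Finset.two_lt_card.1 (not_le.1 hc)
    simp only [Finset.mem_filter, Finset.mem_univ, true_and] at ha hb hc
    obtain ⟨ha1, ha⟩ := ha
    obtain ⟨hb1, hb⟩ := hb
    obtain ⟨hc1, hc⟩ := hc
    rw [goe_off _ _ _ _ ha1] at ha
    rw [goe_off _ _ _ _ hb1] at hb
    rw [goe_off _ _ _ _ hc1] at hc
    exact hC i j a b c ⟨hi, ⟨hab, hac, hbc⟩, ha1, hb1, hc1, ha, hb, hc⟩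

lemma min_meas {n : ℕ} (i : Fin n) : MeasurableSet {d : Fin n → ℝ | ∀ l, d i ≤ d l} := by
  have : {d : Fin n → ℝ | ∀ l, d i ≤ d l} = ⋂ l, {d | d i ≤ d l} := by ext; simp
  rw [this]
  exact MeasurableSet.iInter fun l => measurableSet_le (by fun_prop) (by fun_prop)

lemma min_eq {N : ℕ} (i : Fin (N + 1)) : {d : Fin (N + 1) → ℝ | ∀ l, d i ≤ d l} =
    {d | ∀ l, d (i.succAbove l) ∈ (fun x => Ici x) (d i)} := by
  ext d
  simp [Fin.forall_iff_succAbove i]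

lemma pp_meas : Measurable pp := pp_cont.measurable

lemma I1' {N : ℕ} (i : Fin (N + 1)) (f : ℝ → ℝ≥0∞) (hf : Measurable f) :
    ∫⁻ d in {d | ∀ l, d i ≤ d l}, f (d i)
      ∂(Measure.pi fun _ : Fin (N + 1) => gaussianReal 0 1) =
    ∫⁻ x, gaussianReal 0 1 (Ici x) ^ N * f x ∂(gaussianReal 0 1) := by
  rw [min_eq, I1 i (fun x => Ici x) _ f hf]
  exact measurableSet_le measurable_fst measurable_snd

lemma evA_le {N : ℕ} (i k : Fin (N + 1)) : mun (N + 1) (evA i k) ≤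
    ∫⁻ x, gaussianReal 0 1 (Ici x) ^ N * ENNReal.ofReal (pp x) ∂(gaussianReal 0 1) := by
  by_cases h : i = k
  · have : evA i k = ∅ := by ext p; simp [evA, h]
    rw [this, measure_empty]; exact zero_le
  · have e := prod_all (Measure.pi fun _ : Fin (N + 1) => gaussianReal 0 1) {edge i k h}
      {d | ∀ l, d i ≤ d l} (min_meas i) (fun d => d i) (by fun_prop)
    rw [Finset.card_singleton] at e
    simp only [pow_one] at e
    rw [I1' i (fun x => ENNReal.ofReal (pp x)) pp_meas.ennreal_ofReal] at e
    rw [← e]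
    refine measure_mono ?_
    rintro p ⟨h1, h2, h3⟩
    refine ⟨h1, ?_⟩
    simpa using h3

lemma evB_le {M : ℕ} (i j k : Fin (M + 3)) : mun (M + 3) (evB i j k) ≤
    ∫⁻ x, gaussianReal 0 1 (Ici x) ^ M * Hf x ∂(gaussianReal 0 1) := by
  by_cases h : j ≠ k ∧ j ≠ i ∧ k ≠ i
  · obtain ⟨h, hj, hk⟩ := h
    have e := prod_all (Measure.pi fun _ : Fin (M + 3) => gaussianReal 0 1) {edge j k h}
      {d | ∀ l, d i ≤ d l} (min_meas i)
      (fun d => d i - 1 / 2 * Real.sqrt ((d j - d i) * (d k - d i))) (by fun_prop)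
    rw [Finset.card_singleton] at e
    simp only [pow_one] at e
    rw [I3 i j k hj hk h.symm (fun x y z => ENNReal.ofReal
      (pp (x - 1 / 2 * Real.sqrt ((y - x) * (z - x)))))] at e
    · unfold Hf
      rw [← e]
      refine measure_mono ?_
      rintro p ⟨h1, h2, _, _, h3⟩
      refine ⟨h1, ?_⟩
      simpa using h3
    · refine (pp_meas.comp ?_).ennreal_ofReal
      fun_prop
  · have : evB i j k = ∅ := by ext p; simp [evB]; grind
    rw [this, measure_empty]; exact zero_le

lemma evC_le {N : ℕ} (i j k1 k2 k3 : Fin (N + 1)) : mun (N + 1) (evC i j k1 k2 k3) ≤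
    ∫⁻ x, gaussianReal 0 1 (Ici x) ^ N * ENNReal.ofReal (pp x) ^ 3 ∂(gaussianReal 0 1) := by
  by_cases h : (k1 ≠ k2 ∧ k1 ≠ k3 ∧ k2 ≠ k3) ∧ j ≠ k1 ∧ j ≠ k2 ∧ j ≠ k3
  · obtain ⟨⟨h12, h13, h23⟩, h1, h2, h3⟩ := h
    have e := prod_all (Measure.pi fun _ : Fin (N + 1) => gaussianReal 0 1)
      {edge j k1 h1, edge j k2 h2, edge j k3 h3}
      {d | ∀ l, d i ≤ d l} (min_meas i) (fun d => d i) (by fun_prop)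
    rw [Finset.card_eq_three.2 ⟨_, _, _, fun h => h12 (edge_inj _ _ h),
      fun h => h13 (edge_inj _ _ h), fun h => h23 (edge_inj _ _ h), rfl⟩] at e
    rw [I1' i (fun x => ENNReal.ofReal (pp x) ^ 3) (pp_meas.ennreal_ofReal.pow_const 3)] at e
    rw [← e]
    refine measure_mono ?_
    rintro p ⟨h1, _, _, _, _, h4, h5, h6⟩
    refine ⟨h1, ?_⟩
    simp only [Finset.mem_insert, Finset.mem_singleton, forall_eq_or_imp, forall_eq]
    exact ⟨h4, h5, h6⟩
  · have : evC i j k1 k2 k3 = ∅ := by ext p; simp [evC]; grind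
    rw [this, measure_empty]; exact zero_le

lemma union_le {α β : Type*} [MeasurableSpace α] (μ : Measure α) [Fintype β] (A : β → Set α)
    (c : ℝ≥0∞) (h : ∀ b, μ (A b) ≤ c) : μ (⋃ b, A b) ≤ Fintype.card β * c := by
  refine (measure_iUnion_fintype_le μ A).trans ?_
  refine (Finset.sum_le_sum fun b _ => h b).trans ?_
  simp

lemma upper_enn (M : ℕ) : mun (M + 3) (ev (M + 3)) ≤
    ((M + 3 : ℕ) : ℝ≥0∞) ^ 2 *
      ∫⁻ x, gaussianReal 0 1 (Ici x) ^ (M + 2) * ENNReal.ofReal (pp x) ∂(gaussianReal 0 1) +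
    (((M + 3 : ℕ) : ℝ≥0∞) ^ 3 * ∫⁻ x, gaussianReal 0 1 (Ici x) ^ M * Hf x ∂(gaussianReal 0 1) +
    ((M + 3 : ℕ) : ℝ≥0∞) ^ 5 *
      ∫⁻ x, gaussianReal 0 1 (Ici x) ^ (M + 2) * ENNReal.ofReal (pp x) ^ 3 ∂(gaussianReal 0 1)) := by
  refine (measure_mono (ev_sub (M + 2))).trans ((measure_union_le _ _).trans
    (add_le_add ?_ ((measure_union_le _ _).trans (add_le_add ?_ ?_))))
  · refine (union_le _ _ _ fun q => evA_le _ _).trans (le_of_eq ?_)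
    simp only [Fintype.card_prod, Fintype.card_fin, Nat.cast_mul]
    ring
  · refine (union_le _ _ _ fun q => evB_le _ _ _).trans (le_of_eq ?_)
    simp only [Fintype.card_prod, Fintype.card_fin, Nat.cast_mul]
    ring
  · refine (union_le _ _ _ fun q => evC_le _ _ _ _ _).trans (le_of_eq ?_)
    simp only [Fintype.card_prod, Fintype.card_fin, Nat.cast_mul]
    ring

/-- lower events -/
def evL {N : ℕ} (i : Fin (N + 1)) : Set ((Fin (N + 1) → ℝ) × (Edge (N + 1) → ℝ)) :=
  {p | p.1 ∈ {d : Fin (N + 1) → ℝ | ∀ l, d (i.succAbove l) ∈ (fun x => Ioi x) (d i)} ∧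
    ∃ e ∈ (Finset.univ.image fun l : Fin N => edge i (i.succAbove l) (Fin.succAbove_ne i l).symm),
      p.2 e < p.1 i}

lemma smin_meas {N : ℕ} (i : Fin (N + 1)) :
    MeasurableSet {d : Fin (N + 1) → ℝ | ∀ l, d (i.succAbove l) ∈ (fun x => Ioi x) (d i)} := by
  have : {d : Fin (N + 1) → ℝ | ∀ l, d (i.succAbove l) ∈ (fun x => Ioi x) (d i)} =
    ⋂ l, {d | d i < d (i.succAbove l)} := by ext; simp
  rw [this]
  exact MeasurableSet.iInter fun l => measurableSet_lt (by fun_prop) (by fun_prop)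

lemma evL_meas {N : ℕ} (i : Fin (N + 1)) : MeasurableSet (evL i) := by
  have : {p : (Fin (N + 1) → ℝ) × (Edge (N + 1) → ℝ) | ∃ e ∈ (Finset.univ.image fun l : Fin N =>
      edge i (i.succAbove l) (Fin.succAbove_ne i l).symm), p.2 e < p.1 i} =
      ⋃ e ∈ (Finset.univ.image fun l : Fin N =>
      edge i (i.succAbove l) (Fin.succAbove_ne i l).symm), {p | p.2 e < p.1 i} := by
    ext; simp
  refine (measurable_fst (smin_meas i)).inter (s₂ := {p : (Fin (N + 1) → ℝ) × (Edge (N + 1) → ℝ) |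
    ∃ e ∈ (Finset.univ.image fun l : Fin N =>
      edge i (i.succAbove l) (Fin.succAbove_ne i l).symm), p.2 e < p.1 i}) ?_
  rw [this]
  exact Finset.measurableSet_biUnion _ fun e _ => measurableSet_lt (by fun_prop) (by fun_prop)

lemma evL_eq {N : ℕ} (i : Fin (N + 1)) : mun (N + 1) (evL i) =
    ∫⁻ x, gaussianReal 0 1 (Ioi x) ^ N * ENNReal.ofReal (1 - (1 - pp x) ^ N) ∂(gaussianReal 0 1) := by
  have e := prod_ex (Measure.pi fun _ : Fin (N + 1) => gaussianReal 0 1)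
      (Finset.univ.image fun l : Fin N => edge i (i.succAbove l) (Fin.succAbove_ne i l).symm)
      {d | ∀ l, d (i.succAbove l) ∈ (fun x => Ioi x) (d i)} (smin_meas i) (fun d => d i) (by fun_prop)
  rw [Finset.card_image_of_injective, Finset.card_univ, Fintype.card_fin,
    I1 i (fun x => Ioi x) _ (fun x => ENNReal.ofReal (1 - (1 - pp x) ^ N))] at e
  · exact e
  · exact (measurable_const.sub ((measurable_const.sub pp_meas).pow_const N)).ennreal_ofReal
  · exact measurableSet_lt measurable_fst measurable_snd
  · intro a b hab
    exact Fin.succAbove_right_injective (edge_inj _ _ hab)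

lemma evL_sub {N : ℕ} (i : Fin (N + 1)) : evL i ⊆ ev (N + 1) := by
  rintro ⟨d, o⟩ ⟨h1, e, he, h2⟩
  obtain ⟨l, -, rfl⟩ := Finset.mem_image.1 he
  simp only [mem_ofPred_eq, mem_Ioi] at h1 h2
  have hmin : ∀ l, d i ≤ d l := by
    rw [Fin.forall_iff_succAbove i]
    exact ⟨le_rfl, fun l => (h1 l).le⟩
  obtain ⟨x, hx, hlt⟩ := det_lower (goeMatrix (N + 1) d o) (goe_symm d o) i (i.succAbove l)
    (by rw [goe_diag, goe_diag]; exact hmin _)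
    (by rw [goe_diag, goe_off _ _ _ _ (Fin.succAbove_ne i l).symm]; exact h2)
  rw [goe_diag] at hlt
  exact ⟨x, hx, fun j => lt_of_lt_of_le hlt (hmin j)⟩

lemma lower_enn (N : ℕ) : ((N + 1 : ℕ) : ℝ≥0∞) *
    ∫⁻ x, gaussianReal 0 1 (Ioi x) ^ N * ENNReal.ofReal (1 - (1 - pp x) ^ N) ∂(gaussianReal 0 1) ≤
    mun (N + 1) (ev (N + 1)) := by
  have h : mun (N + 1) (⋃ i, evL i) ≤ mun (N + 1) (ev (N + 1)) :=
    measure_mono (iUnion_subset fun i => evL_sub i)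
  rw [measure_iUnion _ evL_meas, tsum_fintype] at h
  · simp_rw [evL_eq] at h
    simpa using h
  · intro i j hij
    refine Set.disjoint_left.2 ?_
    rintro ⟨d, o⟩ ⟨h1, -⟩ ⟨h2, -⟩
    simp only [mem_ofPred_eq, mem_Ioi] at h1 h2
    obtain ⟨a, rfl⟩ := Fin.exists_succAbove_eq hij.symm
    obtain ⟨b, hb⟩ := Fin.exists_succAbove_eq hij
    have := h2 b
    rw [hb] at this
    exact lt_asymm this (h1 a)

end GOEAux

namespace GOEAux
open Set Topology
open scoped ENNReal

lemma gF_meas : Measurable gF := gF_cont.measurable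

lemma int_aux (N : ℕ) (f : ℝ → ℝ) (hfm : Measurable f) (C : ℝ) (hf : ∀ x, |f x| ≤ C) :
    Integrable (fun x => (1 - gF x) ^ N * f x) (gaussianReal 0 1) := by
  refine Integrable.of_bound (((measurable_const.sub gF_meas).pow_const N).mul
    hfm).aestronglyMeasurable C (Eventually.of_forall fun x => ?_)
  rw [Real.norm_eq_abs, abs_mul]
  have h1 : |(1 - gF x) ^ N| ≤ 1 := by
    rw [abs_of_nonneg (pow_nonneg (by linarith [gF_lt_one x]) _)]
    exact pow_le_one₀ (by linarith [gF_lt_one x]) (by linarith [gF_pos x])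
  calc _ ≤ 1 * C := mul_le_mul h1 (hf x) (abs_nonneg _) zero_le_one
    _ = C := one_mul _

lemma conv (N : ℕ) (f : ℝ → ℝ) (hfm : Measurable f) (C : ℝ) (hf0 : ∀ x, 0 ≤ f x)
    (hf : ∀ x, f x ≤ C) :
    ∫⁻ x, gaussianReal 0 1 (Ici x) ^ N * ENNReal.ofReal (f x) ∂(gaussianReal 0 1) =
      ENNReal.ofReal (∫ x, (1 - gF x) ^ N * f x ∂(gaussianReal 0 1)) := by
  have h0 : ∀ x, 0 ≤ 1 - gF x := fun x => by linarith [gF_lt_one x]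
  rw [ofReal_integral_eq_lintegral_ofReal]
  · congr 1
    ext x
    rw [gauss_Ici, ← ENNReal.ofReal_pow (h0 x), ← ENNReal.ofReal_mul (pow_nonneg (h0 x) _)]
  · exact int_aux N f hfm C fun x => by rw [abs_of_nonneg (hf0 x)]; exact hf x
  · exact Eventually.of_forall fun x => mul_nonneg (pow_nonneg (h0 x) _) (hf0 x)

lemma gpow_le (C : ℝ) (hC : 0 < C) (k : ℕ) (x : ℝ) : C * gF x ^ k ≤ C := by
  have : gF x ^ k ≤ 1 := pow_le_one₀ (gF_pos x).le (gF_lt_one x).le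
  nlinarith

lemma err_le (N k : ℕ) (hN : 0 < N) (C : ℝ) (hC : 0 < C) (h : ℝ → ℝ≥0∞)
    (hh : ∀ x, h x ≤ ENNReal.ofReal (C * gF x ^ k)) :
    ∫⁻ x, gaussianReal 0 1 (Ici x) ^ N * h x ∂(gaussianReal 0 1) ≤
      ENNReal.ofReal (C * (k.factorial / (N : ℝ) ^ (k + 1))) := by
  have h0 : ∀ x, 0 ≤ C * gF x ^ k := fun x => mul_nonneg hC.le (pow_nonneg (gF_pos x).le _)
  refine (lintegral_mono fun x => mul_le_mul_right (hh x) _).trans ?_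
  rw [conv N (fun x => C * gF x ^ k) (measurable_const.mul (gF_meas.pow_const k)) C h0
    (fun x => gpow_le C hC k x)]
  exact ENNReal.ofReal_le_ofReal (moment N k hN _ h0 C fun x => le_rfl)

/-- main integral -/
noncomputable def aI (n : ℕ) : ℝ := ∫ x, (1 - gF x) ^ (n - 1) * pp x ∂(gaussianReal 0 1)

lemma aI_nonneg (n : ℕ) : 0 ≤ aI n :=
  integral_nonneg fun x => mul_nonneg (pow_nonneg (by linarith [gF_lt_one x]) _) (pp_pos x).le

lemma upper_real : ∃ K : ℝ, 0 < K ∧ ∀ n : ℕ, 6 ≤ n →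
    (mun n (ev n)).toReal ≤ (n : ℝ) ^ 2 * aI n + K / n := by
  obtain ⟨C1, hC1, hH⟩ := Hf_bound
  obtain ⟨C2, hC2, hp⟩ := pp_cube
  refine ⟨96 * C1 + 120 * 64 * C2, by positivity, fun n hn => ?_⟩
  obtain ⟨M, rfl⟩ : ∃ M, n = M + 3 := ⟨n - 3, by omega⟩
  have hM : 3 ≤ M := by omega
  have hMr : (3 : ℝ) ≤ M := by exact_mod_cast hM
  have u := upper_enn M
  have e1 := conv (M + 2) pp pp_meas 1 (fun x => (pp_pos x).le) (fun x => (pp_lt_one x).le)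
  have e2 := err_le M 3 (by omega) C1 hC1 Hf (fun x => by
    rw [← ENNReal.ofReal_toReal (ne_top_of_le_ne_top ENNReal.one_ne_top (Hf_le_one x))]
    exact ENNReal.ofReal_le_ofReal (hH x))
  have e3 := err_le (M + 2) 5 (by omega) C2 hC2 (fun x => ENNReal.ofReal (pp x) ^ 3) (fun x => by
    rw [← ENNReal.ofReal_pow (pp_pos x).le]
    exact ENNReal.ofReal_le_ofReal (hp x))
  rw [e1] at u
  have ha : (∫ x, (1 - gF x) ^ (M + 2) * pp x ∂(gaussianReal 0 1)) = aI (M + 3) := rfl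
  rw [ha] at u
  have hn' : ((M + 3 : ℕ) : ℝ≥0∞) = ENNReal.ofReal ((M + 3 : ℕ) : ℝ) := by
    rw [ENNReal.ofReal_natCast]
  have u2 := u.trans (add_le_add le_rfl (add_le_add (mul_le_mul_right e2 _) (mul_le_mul_right e3 _)))
  have hn0 : (0 : ℝ) ≤ ((M + 3 : ℕ) : ℝ) := Nat.cast_nonneg _
  have ha0 := aI_nonneg (M + 3)
  rw [hn', ← ENNReal.ofReal_pow hn0, ← ENNReal.ofReal_pow hn0, ← ENNReal.ofReal_pow hn0,
    ← ENNReal.ofReal_mul (by positivity), ← ENNReal.ofReal_mul (by positivity),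
    ← ENNReal.ofReal_mul (by positivity), ← ENNReal.ofReal_add (by positivity) (by positivity),
    ← ENNReal.ofReal_add (by positivity) (by positivity)] at u2
  refine (ENNReal.toReal_le_of_le_ofReal (by positivity) u2).trans ?_
  gcongr
  push_cast
  have f3 : ((3 : ℕ).factorial : ℝ) = 6 := by norm_num [Nat.factorial]
  have f5 : ((5 : ℕ).factorial : ℝ) = 120 := by norm_num [Nat.factorial]
  rw [f3, f5, add_div]
  refine add_le_add ?_ ?_
  · have hk : ((M : ℝ) + 3) ^ 4 ≤ 16 * (M : ℝ) ^ 4 := by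
      have : ((M : ℝ) + 3) ^ 4 ≤ (2 * (M : ℝ)) ^ 4 := pow_le_pow_left₀ (by positivity) (by linarith) 4
      calc _ ≤ _ := this
        _ = _ := by ring
    rw [le_div_iff₀ (by positivity)]
    have : ((M : ℝ) + 3) ^ 3 * (C1 * (6 / (M : ℝ) ^ (3 + 1))) * ((M : ℝ) + 3) =
      6 * C1 * (((M : ℝ) + 3) ^ 4 / (M : ℝ) ^ 4) := by ring
    rw [this]
    have : ((M : ℝ) + 3) ^ 4 / (M : ℝ) ^ 4 ≤ 16 := by rw [div_le_iff₀ (by positivity)]; exact hk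
    nlinarith
  · have hk : ((M : ℝ) + 3) ^ 6 ≤ 64 * ((M : ℝ) + 2) ^ 6 := by
      have : ((M : ℝ) + 3) ^ 6 ≤ (2 * ((M : ℝ) + 2)) ^ 6 :=
        pow_le_pow_left₀ (by positivity) (by linarith) 6
      calc _ ≤ _ := this
        _ = _ := by ring
    rw [le_div_iff₀ (by positivity)]
    have : ((M : ℝ) + 3) ^ 5 * (C2 * (120 / ((M : ℝ) + 2) ^ (5 + 1))) * ((M : ℝ) + 3) =
      120 * C2 * (((M : ℝ) + 3) ^ 6 / ((M : ℝ) + 2) ^ 6) := by ring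
    rw [this]
    have : ((M : ℝ) + 3) ^ 6 / ((M : ℝ) + 2) ^ 6 ≤ 64 := by rw [div_le_iff₀ (by positivity)]; exact hk
    nlinarith

lemma bern (p : ℝ) (h0 : 0 ≤ p) (h1 : p ≤ 1) (N : ℕ) :
    (1 - p) ^ N ≤ 1 - N * p + (N : ℝ) ^ 2 * p ^ 2 := by
  induction N with
  | zero => simp
  | succ N ih =>
    have := mul_le_mul_of_nonneg_right ih (by linarith : 0 ≤ 1 - p)
    rw [pow_succ]
    refine this.trans ?_
    push_cast
    have hN : (0 : ℝ) ≤ N := Nat.cast_nonneg _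
    have h3 : 0 ≤ (N : ℝ) ^ 2 * p ^ 3 := by positivity
    have h4 : 0 ≤ ((N : ℝ) + 1) * p ^ 2 := by positivity
    nlinarith

lemma lower_real : ∃ K : ℝ, 0 < K ∧ ∀ n : ℕ, 6 ≤ n →
    (n : ℝ) * ((n : ℝ) - 1) * aI n - K / n ≤ (mun n (ev n)).toReal := by
  obtain ⟨C, hC, hp⟩ := pp_sq
  refine ⟨24 * C, by positivity, fun n hn => ?_⟩
  obtain ⟨N, rfl⟩ : ∃ N, n = N + 1 := ⟨n - 1, by omega⟩
  have hN : (5 : ℝ) ≤ N := by exact_mod_cast (by omega : 5 ≤ N)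
  have l := lower_enn N
  have hb : ∀ x, 0 ≤ 1 - (1 - pp x) ^ N ∧ 1 - (1 - pp x) ^ N ≤ 1 := fun x => by
    have a0 : 0 ≤ 1 - pp x := by linarith [pp_lt_one x]
    have a1 := pow_le_one₀ (n := N) a0 (by linarith [pp_pos x])
    have a2 := pow_nonneg a0 N
    constructor <;> linarith
  have hm : Measurable (fun x => 1 - (1 - pp x) ^ N) :=
    measurable_const.sub ((measurable_const.sub pp_meas).pow_const N)
  simp_rw [gauss_Ioi, ← gauss_Ici] at l
  rw [conv N (fun x => 1 - (1 - pp x) ^ N) hm 1 (fun x => (hb x).1) (fun x => (hb x).2),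
    ← ENNReal.ofReal_natCast, ← ENNReal.ofReal_mul (Nat.cast_nonneg _),
    ENNReal.ofReal_le_iff_le_toReal (measure_ne_top _ _)] at l
  refine le_trans ?_ l
  have i1 : Integrable (fun x => (1 - gF x) ^ N * pp x) (gaussianReal 0 1) :=
    int_aux N pp pp_meas 1 fun x => by rw [abs_of_pos (pp_pos x)]; exact (pp_lt_one x).le
  have i2 : Integrable (fun x => (1 - gF x) ^ N * pp x ^ 2) (gaussianReal 0 1) :=
    int_aux N (fun x => pp x ^ 2) (pp_meas.pow_const 2) 1 fun x => by
      rw [abs_of_pos (pow_pos (pp_pos x) 2)]; exact pow_le_one₀ (pp_pos x).le (pp_lt_one x).le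
  have i3 : Integrable (fun x => (1 - gF x) ^ N * (1 - (1 - pp x) ^ N)) (gaussianReal 0 1) :=
    int_aux N _ hm 1 fun x => by rw [abs_of_nonneg (hb x).1]; exact (hb x).2
  have j : (N : ℝ) * aI (N + 1) - (N : ℝ) ^ 2 * ∫ x, (1 - gF x) ^ N * pp x ^ 2 ∂(gaussianReal 0 1) ≤
      ∫ x, (1 - gF x) ^ N * (1 - (1 - pp x) ^ N) ∂(gaussianReal 0 1) := by
    have ha : aI (N + 1) = ∫ x, (1 - gF x) ^ N * pp x ∂(gaussianReal 0 1) := rfl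
    rw [ha, ← integral_const_mul, ← integral_const_mul,
      ← integral_sub (i1.const_mul _) (i2.const_mul _)]
    refine integral_mono ((i1.const_mul _).sub (i2.const_mul _)) i3 fun x => ?_
    have b := bern (pp x) (pp_pos x).le (pp_lt_one x).le N
    have g0 : 0 ≤ (1 - gF x) ^ N := pow_nonneg (by linarith [gF_lt_one x]) _
    have := mul_le_mul_of_nonneg_left (by linarith : N * pp x - (N : ℝ) ^ 2 * pp x ^ 2 ≤
      1 - (1 - pp x) ^ N) g0
    simp only
    nlinarith
  have m := moment N 3 (by omega) (fun x => pp x ^ 2) (fun x => sq_nonneg _) C hp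
  have f3 : ((3 : ℕ).factorial : ℝ) = 6 := by norm_num [Nat.factorial]
  rw [f3] at m
  have m2 := mul_le_mul_of_nonneg_left m (sq_nonneg (N : ℝ))
  have m3 : (N : ℝ) ^ 2 * (C * (6 / (N : ℝ) ^ (3 + 1))) = 6 * C / (N : ℝ) ^ 2 := by
    field_simp
  rw [m3] at m2
  push_cast
  have j2 := mul_le_mul_of_nonneg_left (show (N : ℝ) * aI (N + 1) - 6 * C / (N : ℝ) ^ 2 ≤
    ∫ x, (1 - gF x) ^ N * (1 - (1 - pp x) ^ N) ∂(gaussianReal 0 1) by linarith)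
    (by positivity : (0 : ℝ) ≤ N + 1)
  refine le_trans ?_ j2
  have : ((N : ℝ) + 1) * (6 * C / (N : ℝ) ^ 2) ≤ 24 * C / (N + 1) := by
    rw [le_div_iff₀ (by positivity)]
    have h1 : ((N : ℝ) + 1) * (6 * C / (N : ℝ) ^ 2) * (N + 1) = 6 * C * ((N + 1) ^ 2 / (N : ℝ) ^ 2) := by
      ring
    have h2 : ((N : ℝ) + 1) ^ 2 / (N : ℝ) ^ 2 ≤ 4 := by
      rw [div_le_iff₀ (by positivity)]; nlinarith
    rw [h1]; nlinarith
  have e : ((N : ℝ) + 1) * ((N : ℝ) + 1 - 1) * aI (N + 1) = (N + 1) * (N * aI (N + 1)) := by ring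
  rw [e, mul_sub]
  linarith

lemma final : Tendsto (fun n : ℕ => ((n : ℝ) / Real.sqrt (Real.log n)) * (mun n (ev n)).toReal)
    atTop (𝓝 (2 * Real.sqrt (2 * Real.pi))) := by
  obtain ⟨K1, hK1, hu⟩ := upper_real
  obtain ⟨K2, hK2, hl⟩ := lower_real
  have hlog : Tendsto (fun n : ℕ => Real.sqrt (Real.log n)) atTop atTop :=
    Real.tendsto_sqrt_atTop.comp (Real.tendsto_log_atTop.comp tendsto_natCast_atTop_atTop)
  have hK : ∀ K : ℝ, Tendsto (fun n : ℕ => K / Real.sqrt (Real.log n)) atTop (𝓝 0) :=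
    fun K => tendsto_const_nhds.div_atTop hlog
  have hm : Tendsto (fun n : ℕ => (n : ℝ) ^ 3 / Real.sqrt (Real.log n) * aI n) atTop
    (𝓝 (2 * Real.sqrt (2 * Real.pi))) := main_term
  have h1 : Tendsto (fun n : ℕ => 1 - 1 / (n : ℝ)) atTop (𝓝 1) := by
    simpa using tendsto_const_nhds.sub (tendsto_one_div_atTop_nhds_zero_nat (𝕜 := ℝ))
      (f := fun _ : ℕ => (1 : ℝ))
  have hlow := (h1.mul hm).sub (hK K2)
  have hup := hm.add (hK K1)
  rw [one_mul, sub_zero] at hlow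
  rw [add_zero] at hup
  refine tendsto_of_tendsto_of_tendsto_of_le_of_le' hlow hup ?_ ?_
  · filter_upwards [eventually_ge_atTop 6] with n hn
    have hn0 : (0 : ℝ) < n := by exact_mod_cast (by omega : 0 < n)
    have := mul_le_mul_of_nonneg_left (hl n hn)
      (by positivity : 0 ≤ (n : ℝ) / Real.sqrt (Real.log n))
    refine le_trans (le_of_eq ?_) this
    field_simp
  · filter_upwards [eventually_ge_atTop 6] with n hn
    have hn0 : (0 : ℝ) < n := by exact_mod_cast (by omega : 0 < n)
    have := mul_le_mul_of_nonneg_left (hu n hn)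
      (by positivity : 0 ≤ (n : ℝ) / Real.sqrt (Real.log n))
    refine le_trans this (le_of_eq ?_)
    field_simp

end GOEAux

/-- Under the GOE model, the probability that the minimum of `x ↦ xᵀQx` over the
standard simplex is strictly smaller than the minimum diagonal entry satisfies
`(n/√(log n)) · μ_n(event) → 2√(2π)`. -/
theorem goe_nonvertex_probability_asymptotics :
    Tendsto (fun n : ℕ =>
        ((n : ℝ) / Real.sqrt (Real.log n)) *
          (goeMeasure n {Q | ∃ x ∈ stdSimplex ℝ (Fin n),
              x ⬝ᵥ Q.mulVec x < ⨅ i : Fin n, Q i i}).toReal)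
      atTop (nhds (2 * Real.sqrt (2 * Real.pi))) := by
  refine GOEAux.final.congr' ?_
  filter_upwards [eventually_ge_atTop 1] with n hn
  obtain ⟨N, rfl⟩ : ∃ N, n = N + 1 := ⟨n - 1, by omega⟩
  rw [GOEAux.goe_ev]
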